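/- arXiv:2601.21818 — 3 statements merged into one kernel-verified Lean document; each statement's English description precedes it below -/
import Mathlib

section
/- Let p ≥ 2 and let E be an edge set on V = {0,…,p−1} such that: (a) (i,i) ∈ E for every i (all self-loops present); (b) there is a linear order ≺ on V such that (i,j) ∈ E with i ≠ j implies i ≺ j (the off-diagonal edges form a DAG); (c) for every vertex i there is some j ≠ i with (i,j) ∈ E or (j,i) ∈ E (no isolated nodes). Let Θ be the set of tuples θ = (A, w₂, w₃, w₄) where A is an E-supported Schur stable real p×p matrix with A_{ii} ≠ 0 for all i, and w₂, w₃, w₄ : V → ℝ are respectively entrywise positive, entrywise nonzero, and entrywise positive; identify θ with the point of ℝ^{|E|+3p} recording the entries (A_{ji})_{(i,j)∈E} together with the values of w₂, w₃, w₄. Then the model is generically identifiable: there exists a polynomial q in the |E|+3p parameter coordinates, not the zero polynomial, such that for every θ = (A,w₂,w₃,w₄) ∈ Θ with q(θ) ≠ 0 and every θ′ = (A′,w₂′,w₃′,w₄′) ∈ Θ, if T₂(A,w₂) = T₂(A′,w₂′), T₃(A,w₃) = T₃(A′,w₃′) and T₄(A,w₄) = T₄(A′,w₄′), then A = A′. 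-/
open Matrix

/-- The order-`n` steady-state cumulant tensor. -/
noncomputable def steadyCumulant (p n : ℕ) (A : Matrix (Fin p) (Fin p) ℝ)
    (w : Fin p → ℝ) (i : Fin n → Fin p) : ℝ :=
  ∑' l : ℕ, ∑ r : Fin p, w r * ∏ m : Fin n, (A ^ l) (i m) r

/-- Geometric decay of the powers of a matrix. -/
def PowDecay {p : ℕ} (A : Matrix (Fin p) (Fin p) ℝ) : Prop :=
  ∃ C ρ : ℝ, 0 ≤ C ∧ 0 ≤ ρ ∧ ρ < 1 ∧ ∀ (l : ℕ) (i j : Fin p), |(A ^ l) i j| ≤ C * ρ ^ l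

section gelfand
attribute [local instance] Matrix.linftyOpNormedRing Matrix.linftyOpNormedAlgebra

lemma powDecay_of_spectrum {p : ℕ} (A : Matrix (Fin p) (Fin p) ℝ)
    (h : ∀ μ ∈ spectrum ℂ (A.map (algebraMap ℝ ℂ)), ‖μ‖ < 1) : PowDecay A := by
  set M : Matrix (Fin p) (Fin p) ℂ := A.map (algebraMap ℝ ℂ) with hM
  have hcomplete : CompleteSpace (Matrix (Fin p) (Fin p) ℂ) := 
    FiniteDimensional.complete ℂ _
  have hentry : ∀ (l : ℕ) (i j : Fin p), |(A ^ l) i j| ≤ ‖M ^ l‖ := by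
    intro l i j
    have h1 : M ^ l = (A ^ l).map (algebraMap ℝ ℂ) := by
      rw [hM]
      exact (map_pow ((algebraMap ℝ ℂ).mapMatrix) A l).symm
    have h2 : |(A ^ l) i j| = ‖(M ^ l) i j‖ := by
      rw [h1]; simp
    rw [h2, Matrix.linfty_opNorm_def]
    have h3 : ‖(M ^ l) i j‖₊ ≤ ∑ j', ‖(M ^ l) i j'‖₊ :=
      Finset.single_le_sum (f := fun j' => ‖(M ^ l) i j'‖₊) (fun _ _ => zero_le) (Finset.mem_univ j)
    have h4 : ∑ j', ‖(M ^ l) i j'‖₊ ≤ Finset.univ.sup fun i => ∑ j', ‖(M ^ l) i j'‖₊ :=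
      Finset.le_sup (f := fun i => ∑ j', ‖(M ^ l) i j'‖₊) (Finset.mem_univ i)
    exact_mod_cast h3.trans h4
  have hrad : spectralRadius ℂ M < 1 := by
    rcases (spectrum ℂ M).eq_empty_or_nonempty with he | hne
    · simp [spectralRadius, he]
    · exact_mod_cast spectrum.spectralRadius_lt_of_forall_lt_of_nonempty (r := 1) hne
        (fun k hk => by exact_mod_cast h k hk)
  obtain ⟨r, hr1, hr2⟩ := ENNReal.lt_iff_exists_nnreal_btwn.1 hrad
  have hG := spectrum.pow_nnnorm_pow_one_div_tendsto_nhds_spectralRadius M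
  have hev := (hG.eventually (gt_mem_nhds hr1)).and (Filter.eventually_gt_atTop 0)
  obtain ⟨N, hN⟩ := Filter.eventually_atTop.1 hev
  have hr0 : (0:ℝ) < r := by
    rcases eq_or_ne r 0 with h0 | h0
    · subst h0; simp at hr1
    · exact_mod_cast pos_iff_ne_zero.2 h0
  have hr1' : (r:ℝ) < 1 := by exact_mod_cast hr2
  have hbig : ∀ l, N ≤ l → ‖M ^ l‖ ≤ (r:ℝ) ^ l := by
    intro l hl
    obtain ⟨h1, h2⟩ := hN l hl
    have h2' : (0:ℝ) < l := by exact_mod_cast h2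
    have h3 : ((‖M ^ l‖₊ : ENNReal)) < (r : ENNReal) ^ (l:ℝ) := by
      have := ENNReal.rpow_lt_rpow h1 h2'
      rwa [← ENNReal.rpow_mul, one_div, inv_mul_cancel₀ h2'.ne', ENNReal.rpow_one] at this
    rw [ENNReal.rpow_natCast] at h3
    have h4 : ‖M ^ l‖₊ < r ^ l := by exact_mod_cast h3
    exact le_of_lt (by exact_mod_cast h4)
  refine ⟨1 + ∑ l ∈ Finset.range N, ‖M ^ l‖ / (r:ℝ) ^ l, r, by positivity, hr0.le, hr1', ?_⟩
  intro l i j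
  refine (hentry l i j).trans ?_
  by_cases hl : N ≤ l
  · refine (hbig l hl).trans ?_
    have : 0 ≤ ∑ l ∈ Finset.range N, ‖M ^ l‖ / (r:ℝ) ^ l := by positivity
    have : 0 < (r:ℝ)^l := by positivity
    nlinarith
  · have h1 : ‖M ^ l‖ / (r:ℝ) ^ l ≤ ∑ l ∈ Finset.range N, ‖M ^ l‖ / (r:ℝ) ^ l :=
      Finset.single_le_sum (f := fun l => ‖M ^ l‖ / (r:ℝ) ^ l) (fun _ _ => by positivity) (by simpa using hl)
    have h0 : 0 < (r:ℝ)^l := by positivity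
    have : ‖M ^ l‖ = ‖M ^ l‖ / (r:ℝ) ^ l * (r:ℝ)^l := by field_simp
    rw [this]
    gcongr
    linarith
end gelfand

lemma abs_prod_pow_le {p n : ℕ} {A : Matrix (Fin p) (Fin p) ℝ} {C ρ : ℝ}
    (hC : 0 ≤ C) (h0 : 0 ≤ ρ) (h1 : ρ < 1)
    (h : ∀ (l : ℕ) (i j : Fin p), |(A ^ l) i j| ≤ C * ρ ^ l)
    (i j : Fin (n + 1) → Fin p) (l : ℕ) :
    |∏ m, (A ^ l) (i m) (j m)| ≤ C ^ (n + 1) * ρ ^ l := by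
  rw [Finset.abs_prod]
  calc ∏ m, |(A ^ l) (i m) (j m)| ≤ ∏ _m : Fin (n + 1), C * ρ ^ l :=
        Finset.prod_le_prod (fun _ _ => abs_nonneg _) (fun _ _ => h _ _ _)
    _ = C ^ (n + 1) * (ρ ^ l) ^ (n + 1) := by simp [mul_pow]
    _ ≤ C ^ (n + 1) * ρ ^ l := by
        gcongr
        exact pow_le_of_le_one (by positivity) (pow_le_one₀ h0 h1.le) (by omega)

lemma summable_term {p n : ℕ} {A : Matrix (Fin p) (Fin p) ℝ} (hA : PowDecay A)
    (w : Fin p → ℝ) (i : Fin (n + 1) → Fin p) :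
    Summable fun l : ℕ => ∑ r : Fin p, w r * ∏ m : Fin (n + 1), (A ^ l) (i m) r := by
  obtain ⟨C, ρ, hC, h0, h1, h⟩ := hA
  refine summable_sum fun r _ => Summable.mul_left _ ?_
  refine Summable.of_norm_bounded (g := fun l => C ^ (n + 1) * ρ ^ l)
    ((summable_geometric_of_lt_one h0 h1).mul_left _) fun l => ?_
  exact abs_prod_pow_le hC h0 h1 h i (fun _ => r) l

lemma prod_mul_expand {p n : ℕ} (A B : Matrix (Fin p) (Fin p) ℝ) (i k : Fin n → Fin p) :
    ∏ m, (A * B) (i m) (k m) = ∑ j : Fin n → Fin p, (∏ m, A (i m) (j m)) * ∏ m, B (j m) (k m) := by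
  simp only [Matrix.mul_apply, Finset.prod_univ_sum, Fintype.piFinset_univ, Finset.prod_mul_distrib]

lemma stationarity {p n : ℕ} {A : Matrix (Fin p) (Fin p) ℝ} (hA : PowDecay A)
    (w : Fin p → ℝ) (i : Fin (n + 1) → Fin p) :
    steadyCumulant p (n + 1) A w i =
      (∑ r, w r * ∏ m, (1 : Matrix (Fin p) (Fin p) ℝ) (i m) r) +
      ∑ j : Fin (n + 1) → Fin p, (∏ m, A (i m) (j m)) * steadyCumulant p (n + 1) A w j := by
  unfold steadyCumulant
  rw [(summable_term hA w i).tsum_eq_zero_add]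
  simp only [pow_zero]
  congr 1
  simp only [← tsum_mul_left]
  rw [← Summable.tsum_finsetSum fun j _ => (summable_term hA w j).mul_left _]
  congr 1
  ext l
  simp only [Finset.mul_sum]
  rw [Finset.sum_comm]
  refine Finset.sum_congr rfl fun r _ => ?_
  have := prod_mul_expand A (A ^ l) i (fun _ => r)
  rw [pow_succ', this, Finset.mul_sum]
  refine Finset.sum_congr rfl fun j _ => by ring

lemma sum_cons {p n : ℕ} (f : (Fin (n + 1) → Fin p) → ℝ) :
    ∑ j, f j = ∑ a : Fin p, ∑ j' : Fin n → Fin p, f (Fin.cons a j') := by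
  rw [← Fintype.sum_prod_type' (f := fun a j' => f (Fin.cons a j'))]
  exact (Fintype.sum_equiv (Fin.consEquiv fun _ => Fin p) _ _ (fun _ => rfl)).symm

/-- Stationarity with the first index split off. -/
lemma stationarity_cons {p n : ℕ} {A : Matrix (Fin p) (Fin p) ℝ} (hA : PowDecay A)
    (w : Fin p → ℝ) (k : Fin p) (i : Fin n → Fin p) :
    steadyCumulant p (n + 1) A w (Fin.cons k i) =
      (∑ r, w r * ((1 : Matrix (Fin p) (Fin p) ℝ) k r * ∏ m, (1 : Matrix (Fin p) (Fin p) ℝ) (i m) r)) +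
      ∑ j : Fin n → Fin p, (∏ m, A (i m) (j m)) *
        ∑ a, A k a * steadyCumulant p (n + 1) A w (Fin.cons a j) := by
  rw [stationarity hA, sum_cons, Finset.sum_comm]
  congr 1
  · simp only [Fin.prod_univ_succ]
    rfl
  · refine Finset.sum_congr rfl fun j _ => ?_
    rw [Finset.mul_sum]
    refine Finset.sum_congr rfl fun a _ => ?_
    simp [Fin.prod_univ_succ]
    ring

/-- Row `u` of `A` supported on the diagonal. -/
lemma root_eq {p n : ℕ} {A : Matrix (Fin p) (Fin p) ℝ} (hA : PowDecay A)
    (w : Fin p → ℝ) (u k : Fin p) (hu : ∀ r, r ≠ u → A u r = 0) :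
    steadyCumulant p (n + 2) A w (Fin.cons k fun _ => u) =
      (if k = u then w u else 0) + A u u ^ (n + 1) *
        ∑ a, A k a * steadyCumulant p (n + 2) A w (Fin.cons a fun _ => u) := by
  rw [stationarity_cons hA]
  congr 1
  · rw [Finset.sum_eq_single u]
    · simp [Matrix.one_apply]
    · intro r _ hr
      simp [Matrix.one_apply, hr.symm]
    · simp
  · rw [Finset.sum_eq_single (fun _ => u)]
    · simp
    · intro j _ hj
      obtain ⟨m, hm⟩ := Function.ne_iff.1 hj
      rw [Finset.prod_eq_zero (Finset.mem_univ m) (hu _ hm), zero_mul]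
    · simp

lemma tri_kill {p : ℕ} {lt : Fin p → Fin p → Prop} (wf : WellFounded lt)
    {A : Matrix (Fin p) (Fin p) ℝ} (htri : ∀ i j, A j i ≠ 0 → i ≠ j → lt i j)
    (hdiag : ∀ i, A i i ≠ 0) (tr : ∀ a b c, lt a b → lt b c → lt a c) (v : Fin p) (y : Fin p → ℝ)
    (h : ∀ i, lt i v → ∑ j, A i j * y j = 0) : ∀ i, lt i v → y i = 0 := by
  intro i
  induction i using wf.induction with
  | _ i ih =>
    intro hi
    have := h i hi
    rw [Finset.sum_eq_single i] at this
    · exact (mul_eq_zero.1 this).resolve_left (hdiag i)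
    · intro j _ hj
      by_cases hz : A i j = 0
      · simp [hz]
      · have := htri j i hz hj
        rw [ih j this (tr _ _ _ this hi), mul_zero]
    · simp

lemma tri_kill_multi {p : ℕ} {lt : Fin p → Fin p → Prop} (wf : WellFounded lt)
    {A : Matrix (Fin p) (Fin p) ℝ} (htri : ∀ i j, A j i ≠ 0 → i ≠ j → lt i j)
    (hdiag : ∀ i, A i i ≠ 0) (tr : ∀ a b c, lt a b → lt b c → lt a c) (v : Fin p) (n : ℕ) :
    ∀ y : (Fin n → Fin p) → ℝ,
    (∀ i : Fin n → Fin p, (∀ m, lt (i m) v) → ∑ j : Fin n → Fin p, (∏ m, A (i m) (j m)) * y j = 0) →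
    ∀ i : Fin n → Fin p, (∀ m, lt (i m) v) → y i = 0 := by
  induction n with
  | zero =>
    intro y h i hi
    have := h i hi
    simpa [Subsingleton.elim i default] using this
  | succ n ih =>
    intro y h i hi
    have key : ∀ a, lt a v → ∀ i' : Fin n → Fin p, (∀ m, lt (i' m) v) → y (Fin.cons a i') = 0 := by
      intro a ha
      refine ih (fun i' => y (Fin.cons a i')) ?_
      intro i' hi'
      refine tri_kill wf htri hdiag tr v
        (fun a => ∑ j : Fin n → Fin p, (∏ m, A (i' m) (j m)) * y (Fin.cons a j)) ?_ a ha
      intro b hb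
      have := h (Fin.cons b i') (fun m => by
        refine Fin.cases ?_ ?_ m
        · simpa using hb
        · intro m; simpa using hi' m)
      rw [sum_cons] at this
      rw [← this]
      refine Finset.sum_congr rfl fun a _ => ?_
      rw [Finset.mul_sum]
      refine Finset.sum_congr rfl fun j _ => ?_
      simp [Fin.prod_univ_succ, mul_assoc]
    rw [← Fin.cons_self_tail i]
    exact key _ (hi 0) _ (fun m => hi m.succ)

/-- The linear relations for the difference of the rows `v`. -/
lemma row_diff {p n : ℕ} {lt : Fin p → Fin p → Prop} (wf : WellFounded lt)
    (irr : ∀ a, ¬ lt a a)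
    {A A' : Matrix (Fin p) (Fin p) ℝ} (htri : ∀ i j, A j i ≠ 0 → i ≠ j → lt i j)
    (hdiag : ∀ i, A i i ≠ 0) (tr : ∀ a b c, lt a b → lt b c → lt a c)
    (hA : PowDecay A) (hA' : PowDecay A') (w w' : Fin p → ℝ)
    (hT : steadyCumulant p (n + 2) A w = steadyCumulant p (n + 2) A' w') (v : Fin p)
    (hrow : ∀ k, lt k v → A k = A' k) (i : Fin (n + 1) → Fin p) (hi : ∀ m, lt (i m) v) :
    ∑ k, (A v k - A' v k) * steadyCumulant p (n + 2) A w (Fin.cons k i) = 0 := by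
  refine tri_kill_multi wf htri hdiag tr v (n + 1)
    (fun i => ∑ k, (A v k - A' v k) * steadyCumulant p (n + 2) A w (Fin.cons k i)) ?_ i hi
  intro i hi
  have e1 := stationarity_cons hA w v i
  have e2 := stationarity_cons hA' w' v i
  have z : ∀ w : Fin p → ℝ, (∑ r, w r * ((1 : Matrix (Fin p) (Fin p) ℝ) v r *
      ∏ m, (1 : Matrix (Fin p) (Fin p) ℝ) (i m) r)) = 0 := by
    intro w
    refine Finset.sum_eq_zero fun r _ => ?_
    by_cases hr : v = r
    · subst hr
      have : i 0 ≠ v := fun h => irr v (by simpa [h] using hi 0)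
      rw [Finset.prod_eq_zero (Finset.mem_univ 0) (by simp [Matrix.one_apply, this])]
      simp
    · simp [Matrix.one_apply, hr]
  rw [z, zero_add] at e1 e2
  rw [← hT] at e2
  have e3 : ∀ j : Fin (n + 1) → Fin p, ∏ m, A' (i m) (j m) = ∏ m, A (i m) (j m) := fun j =>
    Finset.prod_congr rfl fun m _ => by rw [hrow _ (hi m)]
  simp only [e3] at e2
  simp only [sub_mul, Finset.sum_sub_distrib, mul_sub]
  rw [← e1, ← e2, sub_self]

lemma root_zero {p : ℕ} {lt : Fin p → Fin p → Prop} (wf : WellFounded lt)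
    {A : Matrix (Fin p) (Fin p) ℝ} (htri : ∀ i j, A j i ≠ 0 → i ≠ j → lt i j)
    (tr : ∀ a b c, lt a b → lt b c → lt a c) (u v : Fin p)
    (hchild : ∀ k, lt k v → k ≠ u → A k u = 0) (l : ℕ) :
    ∀ k, lt k v → k ≠ u → (A ^ l) k u = 0 := by
  induction l with
  | zero => intro k _ hk; simp [Matrix.one_apply, hk]
  | succ l ih =>
    intro k hk hku
    rw [pow_succ', Matrix.mul_apply]
    refine Finset.sum_eq_zero fun m _ => ?_
    by_cases hz : A k m = 0
    · simp [hz]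
    by_cases hmu : m = u
    · subst hmu; exact absurd (hchild k hk hku) hz
    by_cases hmk : m = k
    · subst hmk; simp [ih m hk hku]
    · rw [ih m (tr _ _ _ (htri m k hz hmk) hk) hmu, mul_zero]

lemma root_pow {p : ℕ} {A : Matrix (Fin p) (Fin p) ℝ} (u : Fin p)
    (hu : ∀ r, r ≠ u → A u r = 0) (l : ℕ) : ∀ r, r ≠ u → (A ^ l) u r = 0 := by
  induction l with
  | zero => intro r hr; simp [Matrix.one_apply, hr.symm]
  | succ l ih =>
    intro r hr
    rw [pow_succ', Matrix.mul_apply]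
    refine Finset.sum_eq_zero fun m _ => ?_
    by_cases hm : m = u
    · subst hm; simp [ih r hr]
    · simp [hu m hm]

/-- The equations for a root `u` and its first child `v`. -/
lemma root_child {p n : ℕ} {lt : Fin p → Fin p → Prop} (wf : WellFounded lt)
    (tri : ∀ a b, lt a b ∨ a = b ∨ lt b a)
    {A : Matrix (Fin p) (Fin p) ℝ} (htri : ∀ i j, A j i ≠ 0 → i ≠ j → lt i j)
    (tr : ∀ a b c, lt a b → lt b c → lt a c) (hA : PowDecay A) (w : Fin p → ℝ) (u v : Fin p)
    (huv : u ≠ v) (hu : ∀ r, r ≠ u → A u r = 0)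
    (hchild : ∀ k, lt k v → k ≠ u → A k u = 0) :
    steadyCumulant p (n + 2) A w (Fin.cons u fun _ => u) = w u + A u u ^ (n + 2) *
      steadyCumulant p (n + 2) A w (Fin.cons u fun _ => u) ∧
    steadyCumulant p (n + 2) A w (Fin.cons v fun _ => u) = A u u ^ (n + 1) *
      (A v u * steadyCumulant p (n + 2) A w (Fin.cons u fun _ => u) +
       A v v * steadyCumulant p (n + 2) A w (Fin.cons v fun _ => u)) := by
  have hz : ∀ k, lt k v → k ≠ u → steadyCumulant p (n + 2) A w (Fin.cons k fun _ => u) = 0 := by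
    intro k hk hku
    unfold steadyCumulant
    have : ∀ l : ℕ, ∑ r, w r * ∏ m : Fin (n + 2), (A ^ l) ((Fin.cons k fun _ => u : Fin (n+2) → Fin p) m) r = 0 := by
      intro l
      refine Finset.sum_eq_zero fun r _ => ?_
      rw [Fin.prod_univ_succ]
      by_cases hr : r = u
      · subst hr
        simp [root_zero wf htri tr r v hchild l k hk hku]
      · simp [root_pow u hu l r hr]
    simp only [this, tsum_zero]
  constructor
  · have := root_eq (n := n) hA w u u hu
    rw [Finset.sum_eq_single u (fun b _ hb => by simp [hu b hb]) (by simp)] at this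
    simp only [if_true] at this
    linear_combination this
  · have := root_eq (n := n) hA w u v hu
    rw [Fintype.sum_eq_add u v huv (fun x hx => ?_)] at this
    · simpa [huv.symm] using this
    · by_cases h0 : A v x = 0
      · simp [h0]
      · rw [hz x (htri x v h0 hx.2) hx.1, mul_zero]

lemma root_algebra (a b c a' b' c' : ℝ) (hb : b ≠ 0) (t s : Fin 3 → ℝ) (ha : a ≠ 0) (ha' : a' ≠ 0)
    (ha1 : a ≠ 1) (ha1' : a' ≠ 1) (ht : ∀ n, t n ≠ 0)
    (h : ∀ n : Fin 3, s n = a ^ (n.val + 1) * (b * t n + c * s n))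
    (h' : ∀ n : Fin 3, s n = a' ^ (n.val + 1) * (b' * t n + c' * s n)) : a = a' := by
  have hs : ∀ n, s n ≠ 0 := by
    intro n h0
    have := h n
    rw [h0] at this
    have h3 : a ^ (n.val + 1) * (b * t n) = 0 := by linear_combination -this
    exact mul_ne_zero (pow_ne_zero _ ha) (mul_ne_zero hb (ht n)) h3
  set x : ℝ := a⁻¹ with hx
  set x' : ℝ := a'⁻¹ with hx'
  have e : ∀ n : Fin 3, b * (t n / s n) + c = x ^ (n.val + 1) := by
    intro n
    have h1 := h n
    have h2 := hs n
    rw [hx, inv_pow]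
    have := pow_ne_zero (n.val + 1) ha
    field_simp
    linear_combination -h1
  have e' : ∀ n : Fin 3, b' * (t n / s n) + c' = x' ^ (n.val + 1) := by
    intro n
    have h1 := h' n
    have h2 := hs n
    rw [hx', inv_pow]
    have := pow_ne_zero (n.val + 1) ha'
    field_simp
    linear_combination -h1
  have e0 := e 0
  have e1 := e 1
  have e2 := e 2
  have f0 := e' 0
  have f1 := e' 1
  have f2 := e' 2
  generalize t 0 / s 0 = r0 at *
  generalize t 1 / s 1 = r1 at *
  generalize t 2 / s 2 = r2 at *
  simp at e0 e1 e2 f0 f1 f2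
  have hx0 : x ≠ 0 := inv_ne_zero ha
  have hx0' : x' ≠ 0 := inv_ne_zero ha'
  have hx1 : x - 1 ≠ 0 := fun h => ha1 (by rw [← inv_inv a, ← hx, sub_eq_zero.1 h, inv_one])
  have hx1' : x' - 1 ≠ 0 := fun h => ha1' (by rw [← inv_inv a', ← hx', sub_eq_zero.1 h, inv_one])
  have g1 : b * (r1 - r0) = x * (x - 1) := by linear_combination e1 - e0
  have g2 : b * (r2 - r1) = x ^ 2 * (x - 1) := by linear_combination e2 - e1
  have g1' : b' * (r1 - r0) = x' * (x' - 1) := by linear_combination f1 - f0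
  have g2' : b' * (r2 - r1) = x' ^ 2 * (x' - 1) := by linear_combination f2 - f1
  have g3 : b * ((r2 - r1) - x * (r1 - r0)) = 0 := by linear_combination g2 - x * g1
  have g4 := (mul_eq_zero.1 g3).resolve_left hb
  have g5 : (x' * (x' - 1)) * (x' - x) = 0 := by
    linear_combination (-1) * g2' + b' * g4 + x * g1'
  have g6 := (mul_eq_zero.1 g5).resolve_left (mul_ne_zero hx0' hx1')
  exact inv_injective (show a⁻¹ = a'⁻¹ by rw [← hx, ← hx']; linarith)

lemma root_ident {p : ℕ} {lt : Fin p → Fin p → Prop} (wf : WellFounded lt)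
    (tri : ∀ a b, lt a b ∨ a = b ∨ lt b a)
    (tr : ∀ a b c, lt a b → lt b c → lt a c)
    {A A' : Matrix (Fin p) (Fin p) ℝ} (htri : ∀ i j, A j i ≠ 0 → i ≠ j → lt i j)
    (htri' : ∀ i j, A' j i ≠ 0 → i ≠ j → lt i j)
    (hA : PowDecay A) (hA' : PowDecay A') (w w' : Fin 3 → Fin p → ℝ) (u v : Fin p)
    (huv : u ≠ v) (hu : ∀ r, r ≠ u → A u r = 0) (hu' : ∀ r, r ≠ u → A' u r = 0)
    (hchild : ∀ k, lt k v → k ≠ u → A k u = 0) (hchild' : ∀ k, lt k v → k ≠ u → A' k u = 0)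
    (h0 : A u u ≠ 0) (h0' : A' u u ≠ 0) (hb : A v u ≠ 0)
    (hw : ∀ n, w n u ≠ 0) (hw' : ∀ n, w' n u ≠ 0)
    (hT : ∀ n : Fin 3, steadyCumulant p (n.val + 2) A (w n) = steadyCumulant p (n.val + 2) A' (w' n)) :
    A u u = A' u u := by
  have r := fun n : Fin 3 => root_child (n := n.val) wf tri htri tr hA (w n) u v huv hu hchild
  have r' := fun n : Fin 3 => root_child (n := n.val) wf tri htri' tr hA' (w' n) u v huv hu' hchild'
  simp only [← hT] at r'
  refine root_algebra (A u u) (A v u) (A v v) (A' u u) (A' v u) (A' v v) hb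
    (fun n : Fin 3 => steadyCumulant p (n.val + 2) A (w n) (Fin.cons u fun _ => u))
    (fun n : Fin 3 => steadyCumulant p (n.val + 2) A (w n) (Fin.cons v fun _ => u)) h0 h0' ?_ ?_ ?_
    (fun n => (r n).2) (fun n => (r' n).2)
  · intro h1
    have := (r 0).1
    rw [h1] at this
    exact hw 0 (by linear_combination -this)
  · intro h1
    have := (r' 0).1
    rw [h1] at this
    exact hw' 0 (by linear_combination -this)
  · intro n hz
    have := (r n).1
    rw [hz] at this
    exact hw n (by linear_combination -this)

/-- Functions on `S` which are rational with denominators nonvanishing on `S`. -/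
def IsRat {σ : Type*} (S : Set (σ → ℝ)) (F : (σ → ℝ) → ℝ) : Prop :=
  ∃ P Q : MvPolynomial σ ℝ, ∀ θ ∈ S, MvPolynomial.eval θ Q ≠ 0 ∧
    F θ * MvPolynomial.eval θ Q = MvPolynomial.eval θ P

namespace IsRat
variable {σ : Type*} {S : Set (σ → ℝ)} {F G : (σ → ℝ) → ℝ}

lemma const (c : ℝ) : IsRat S fun _ => c := ⟨MvPolynomial.C c, 1, fun θ _ => by simp⟩

lemma coord (s : σ) : IsRat S fun θ => θ s := ⟨MvPolynomial.X s, 1, fun θ _ => by simp⟩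

lemma add (hF : IsRat S F) (hG : IsRat S G) : IsRat S fun θ => F θ + G θ := by
  obtain ⟨P, Q, h⟩ := hF
  obtain ⟨P', Q', h'⟩ := hG
  refine ⟨P * Q' + P' * Q, Q * Q', fun θ hθ => ?_⟩
  obtain ⟨h1, h2⟩ := h θ hθ
  obtain ⟨h1', h2'⟩ := h' θ hθ
  simp only [map_mul, map_add]
  exact ⟨mul_ne_zero h1 h1', by rw [← h2, ← h2']; ring⟩

lemma mul (hF : IsRat S F) (hG : IsRat S G) : IsRat S fun θ => F θ * G θ := by
  obtain ⟨P, Q, h⟩ := hF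
  obtain ⟨P', Q', h'⟩ := hG
  refine ⟨P * P', Q * Q', fun θ hθ => ?_⟩
  obtain ⟨h1, h2⟩ := h θ hθ
  obtain ⟨h1', h2'⟩ := h' θ hθ
  simp only [map_mul]
  exact ⟨mul_ne_zero h1 h1', by rw [← h2, ← h2']; ring⟩

lemma inv (hF : IsRat S F) (h0 : ∀ θ ∈ S, F θ ≠ 0) : IsRat S fun θ => (F θ)⁻¹ := by
  obtain ⟨P, Q, h⟩ := hF
  refine ⟨Q, P, fun θ hθ => ?_⟩
  obtain ⟨h1, h2⟩ := h θ hθ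
  have := h0 θ hθ
  rw [← h2]
  exact ⟨mul_ne_zero this h1, by field_simp⟩

lemma congr (hF : IsRat S F) (h : ∀ θ ∈ S, F θ = G θ) : IsRat S G := by
  obtain ⟨P, Q, h1⟩ := hF
  exact ⟨P, Q, fun θ hθ => by rw [← h θ hθ]; exact h1 θ hθ⟩

lemma sum {ι : Type*} (s : Finset ι) {f : ι → (σ → ℝ) → ℝ} (h : ∀ i ∈ s, IsRat S (f i)) :
    IsRat S fun θ => ∑ i ∈ s, f i θ := by
  classical
  induction s using Finset.induction_on with
  | empty => simpa using const (S := S) 0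
  | insert a s ha ih =>
    simp only [Finset.sum_insert ha]
    exact (h a (by simp)).add (ih fun i hi => h i (by simp [hi]))

lemma prod {ι : Type*} (s : Finset ι) {f : ι → (σ → ℝ) → ℝ} (h : ∀ i ∈ s, IsRat S (f i)) :
    IsRat S fun θ => ∏ i ∈ s, f i θ := by
  classical
  induction s using Finset.induction_on with
  | empty => simpa using const (S := S) 1
  | insert a s ha ih =>
    simp only [Finset.prod_insert ha]
    exact (h a (by simp)).mul (ih fun i hi => h i (by simp [hi]))

lemma det {ι : Type*} [Fintype ι] [DecidableEq ι] {M : (σ → ℝ) → Matrix ι ι ℝ}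
    (h : ∀ i j, IsRat S fun θ => M θ i j) : IsRat S fun θ => (M θ).det := by
  simp only [Matrix.det_apply']
  exact sum _ fun τ _ => (const _).mul (prod _ fun i _ => h _ _)

lemma exists_poly (hF : IsRat S F) {θ₀ : σ → ℝ} (h0 : θ₀ ∈ S) (hne : F θ₀ ≠ 0) :
    ∃ P : MvPolynomial σ ℝ, P ≠ 0 ∧ ∀ θ ∈ S, MvPolynomial.eval θ P ≠ 0 → F θ ≠ 0 := by
  obtain ⟨P, Q, h⟩ := hF
  refine ⟨P, ?_, ?_⟩
  · rintro rfl
    obtain ⟨h1, h2⟩ := h θ₀ h0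
    simp at h2
    tauto
  · intro θ hθ hP hF
    obtain ⟨h1, h2⟩ := h θ hθ
    rw [hF, zero_mul] at h2
    exact hP h2.symm

end IsRat

/-- The Kronecker power of `A`. -/
def kpow {p : ℕ} (n : ℕ) (A : Matrix (Fin p) (Fin p) ℝ) :
    Matrix (Fin n → Fin p) (Fin n → Fin p) ℝ := fun i j => ∏ m, A (i m) (j m)

lemma det_ne_zero_kpow {p n : ℕ} {A : Matrix (Fin p) (Fin p) ℝ} (hA : PowDecay A) :
    (1 - kpow (n + 1) A).det ≠ 0 := by
  intro h
  obtain ⟨x, hx, hz⟩ := Matrix.exists_mulVec_eq_zero_iff.2 h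
  rw [Matrix.sub_mulVec, Matrix.one_mulVec, sub_eq_zero] at hz
  have hit : ∀ l : ℕ, ∀ i, x i = ∑ j, (∏ m, (A ^ l) (i m) (j m)) * x j := by
    intro l
    have hx1 : ∀ l, kpow (n + 1) (A ^ (l + 1)) = kpow (n + 1) A * kpow (n + 1) (A ^ l) := by
      intro l
      ext i k
      rw [pow_succ', Matrix.mul_apply]
      exact prod_mul_expand A (A ^ l) i k
    have h1 : x = kpow (n + 1) (A ^ l) *ᵥ x := by
      induction l with
      | zero =>
        have : kpow (n + 1) (A ^ 0) = 1 := by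
          ext i k
          by_cases hik : i = k
          · subst hik; simp [kpow]
          · obtain ⟨m, hm⟩ := Function.ne_iff.1 hik
            rw [Matrix.one_apply_ne hik, kpow,
              Finset.prod_eq_zero (Finset.mem_univ m) (by simp [hm])]
        rw [this, Matrix.one_mulVec]
      | succ l ih => rw [hx1, ← Matrix.mulVec_mulVec, ← ih, ← hz]
    intro i
    exact congrFun h1 i
  obtain ⟨C, ρ, hC, h0, h1, hb⟩ := hA
  refine hx (funext fun i => ?_)
  have hlim : Filter.Tendsto (fun l : ℕ => ∑ j, (∏ m, (A ^ l) (i m) (j m)) * x j) Filter.atTop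
      (nhds (∑ j : Fin (n + 1) → Fin p, 0 * x j)) := by
    refine tendsto_finsetSum _ fun j _ => Filter.Tendsto.mul_const _ ?_
    refine squeeze_zero_norm (fun l => abs_prod_pow_le hC h0 h1 hb i j l) ?_
    simpa using (tendsto_pow_atTop_nhds_zero_of_lt_one h0 h1).const_mul (C ^ (n + 1))
  simp only [← hit, zero_mul, Finset.sum_const_zero] at hlim
  exact tendsto_nhds_unique tendsto_const_nhds hlim

lemma IsRat.cumulant {σ : Type*} {S : Set (σ → ℝ)} {p n : ℕ}
    {A : (σ → ℝ) → Matrix (Fin p) (Fin p) ℝ} {w : (σ → ℝ) → Fin p → ℝ}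
    (hS : ∀ θ ∈ S, PowDecay (A θ)) (hA : ∀ i j, IsRat S fun θ => A θ i j)
    (hw : ∀ i, IsRat S fun θ => w θ i) (i : Fin (n + 1) → Fin p) :
    IsRat S fun θ => steadyCumulant p (n + 1) (A θ) (w θ) i := by
  have hM : ∀ i j, IsRat S fun θ => (1 - kpow (n + 1) (A θ)) i j := by
    intro i j
    simp only [Matrix.sub_apply, sub_eq_add_neg, neg_eq_neg_one_mul (kpow _ _ _ _)]
    exact (IsRat.const _).add ((IsRat.const _).mul (IsRat.prod _ fun m _ => hA _ _))
  have hD := IsRat.inv (IsRat.det hM) (fun θ hθ => det_ne_zero_kpow (hS θ hθ))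
  let D : (σ → ℝ) → (Fin (n + 1) → Fin p) → ℝ := fun θ i =>
    ∑ r, w θ r * ∏ m, (1 : Matrix (Fin p) (Fin p) ℝ) (i m) r
  have hDr : ∀ i, IsRat S fun θ => D θ i := fun i =>
    IsRat.sum _ fun r _ => (hw r).mul (IsRat.const _)
  have hadj : ∀ i j, IsRat S fun θ => (1 - kpow (n + 1) (A θ)).adjugate i j := by
    intro i j
    simp only [Matrix.adjugate_apply]
    refine IsRat.det fun a b => ?_
    simp only [Matrix.updateRow_apply]
    split_ifs
    · exact IsRat.const _
    · exact hM _ _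
  refine IsRat.congr (hD.mul (IsRat.sum Finset.univ fun j _ => (hadj i j).mul (hDr j))) ?_
  intro θ hθ
  have hne := det_ne_zero_kpow (n := n) (hS θ hθ)
  have hst : (1 - kpow (n + 1) (A θ)) *ᵥ steadyCumulant p (n + 1) (A θ) (w θ) = D θ := by
    rw [Matrix.sub_mulVec, Matrix.one_mulVec]
    funext i
    rw [Pi.sub_apply, stationarity (hS θ hθ)]
    exact add_sub_cancel_right _ _
  have h2 := congrFun (congrArg (fun z => (1 - kpow (n + 1) (A θ)).adjugate *ᵥ z) hst) i
  simp only [Matrix.mulVec_mulVec, Matrix.adjugate_mul, Matrix.smul_mulVec, Matrix.one_mulVec] at h2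
  have h3 : ∑ j, (1 - kpow (n + 1) (A θ)).adjugate i j * D θ j =
    (1 - kpow (n + 1) (A θ)).det * steadyCumulant p (n + 1) (A θ) (w θ) i := h2.symm
  rw [h3]
  field_simp

open Classical in
/-- The square system determining row `v`, using the parent `u`. -/
noncomputable def sysMat {p : ℕ} (lt : Fin p → Fin p → Prop) (u v : Fin p)
    (A : Matrix (Fin p) (Fin p) ℝ) (w₂ w₃ : Fin p → ℝ) : Matrix (Fin p) (Fin p) ℝ := fun j k =>
  if lt j v then steadyCumulant p 2 A w₂ (Fin.cons k fun _ => j)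
  else if j = v then steadyCumulant p 3 A w₃ (Fin.cons k fun _ => u)
  else if j = k then 1 else 0

/-- The matrix with diagonal entry `1/2` at `u` and the edge `u → v` of weight one. -/
noncomputable def testMat {p : ℕ} (u v : Fin p) : Matrix (Fin p) (Fin p) ℝ := fun j i =>
  if i = u then (if j = u then 1 / 2 else if j = v then 1 else 0) else 0

lemma testMat_decay {p : ℕ} (u v : Fin p) : PowDecay (testMat u v) := by
  have hsq : testMat u v * testMat u v = (1 / 2 : ℝ) • testMat u v := by
    ext j i
    rw [Matrix.mul_apply, Finset.sum_eq_single u]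
    · simp only [testMat, Matrix.smul_apply, smul_eq_mul]
      split_ifs <;> norm_num
    · intro m _ hm
      simp [testMat, hm]
    · simp
  have hp : ∀ l : ℕ, testMat u v ^ (l + 1) = (1 / 2 : ℝ) ^ l • testMat u v := by
    intro l
    induction l with
    | zero => simp
    | succ l ih => rw [pow_succ, ih, Matrix.smul_mul, hsq, smul_smul, pow_succ]
  refine ⟨2, 1 / 2, by norm_num, by norm_num, by norm_num, ?_⟩
  intro l i j
  cases l with
  | zero =>
    simp only [pow_zero, Matrix.one_apply]
    split_ifs <;> norm_num
  | succ l =>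
    rw [hp, Matrix.smul_apply, smul_eq_mul, abs_mul, abs_of_nonneg (by positivity), pow_succ]
    have : |testMat u v i j| ≤ 1 := by
      simp only [testMat]
      split_ifs <;> norm_num [abs_of_pos]
    have h2 : (0:ℝ) < (1 / 2) ^ l := by positivity
    nlinarith

lemma testMat_det {p : ℕ} (lt : Fin p → Fin p → Prop) (irr : ∀ a, ¬ lt a a) (u v : Fin p)
    (huv : lt u v) : (sysMat lt u v (testMat u v) 1 1).det ≠ 0 := by
  have hne : u ≠ v := fun h => irr v (h ▸ huv)
  have hA := testMat_decay u v
  have hroot : ∀ r, r ≠ u → testMat u v u r = 0 := fun r hr => by simp [testMat, hr]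
  have hz : ∀ n k, k ≠ u → k ≠ v →
      steadyCumulant p (n + 2) (testMat u v) 1 (Fin.cons k fun _ => u) = 0 := by
    intro n k h1 h2
    rw [root_eq hA 1 u k hroot]
    simp [h1, h2, testMat]
  have hv : ∀ n, steadyCumulant p (n + 2) (testMat u v) 1 (Fin.cons v fun _ => u) =
      (1 / 2) ^ (n + 1) * steadyCumulant p (n + 2) (testMat u v) 1 (Fin.cons u fun _ => u) := by
    intro n
    rw [root_eq hA 1 u v hroot, Finset.sum_eq_single u]
    · simp [hne.symm, testMat]
    · intro r _ hr
      simp [testMat, hr]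
    · simp
  have hu : ∀ n, steadyCumulant p (n + 2) (testMat u v) 1 (Fin.cons u fun _ => u) ≠ 0 := by
    intro n h0
    have := root_eq (n := n) hA 1 u u hroot
    rw [Finset.sum_eq_single u (fun b _ hb => by simp [hroot b hb]) (by simp), h0] at this
    simp at this
  have hother : ∀ j k, j ≠ u → j ≠ v →
      steadyCumulant p 2 (testMat u v) 1 (Fin.cons k fun _ => j) = if j = k then 1 else 0 := by
    intro j k h1 h2
    have := root_eq (n := 0) hA 1 j k (fun r _ => by simp [testMat, h1, h2])
    rw [this]
    simp [testMat, h1, h2, eq_comm]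
  intro hdet
  obtain ⟨x, hx, hN⟩ := Matrix.exists_mulVec_eq_zero_iff.2 hdet
  have hrow : ∀ j, ∑ k, sysMat lt u v (testMat u v) 1 1 j k * x k = 0 := fun j => congrFun hN j
  have hx0 : ∀ j, j ≠ u → j ≠ v → x j = 0 := by
    intro j h1 h2
    have h := hrow j
    have he : ∀ k, sysMat lt u v (testMat u v) 1 1 j k = if j = k then 1 else 0 := by
      intro k
      unfold sysMat
      rw [hother j k h1 h2]
      simp [h2]
    simpa [he] using h
  have e1 := hrow u
  have e2 := hrow v
  simp only [sysMat, huv, irr, if_true, if_false] at e1 e2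
  rw [Fintype.sum_eq_add u v hne (fun k hk => by rw [hz 0 k hk.1 hk.2, zero_mul]), hv 0] at e1
  rw [Fintype.sum_eq_add u v hne (fun k hk => by rw [hz 1 k hk.1 hk.2, zero_mul]), hv 1] at e2
  have e1' : x u + 1 / 2 * x v = 0 := by
    refine (mul_eq_zero.1 (?_ : steadyCumulant p (0 + 2) (testMat u v) 1
      (Fin.cons u fun _ => u) * _ = 0)).resolve_left (hu 0)
    linear_combination e1
  have e2' : x u + 1 / 4 * x v = 0 := by
    refine (mul_eq_zero.1 (?_ : steadyCumulant p (1 + 2) (testMat u v) 1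
      (Fin.cons u fun _ => u) * _ = 0)).resolve_left (hu 1)
    linear_combination e2
  refine hx (funext fun j => ?_)
  by_cases h1 : j = u
  · subst h1; simp only [Pi.zero_apply]; linarith
  by_cases h2 : j = v
  · subst h2; simp only [Pi.zero_apply]; linarith
  exact hx0 j h1 h2

open Classical in
/-- The matrix encoded by a parameter vector. -/
noncomputable def paramMat {p : ℕ} {E : Finset (Fin p × Fin p)}
    (θ : {e : Fin p × Fin p // e ∈ E} ⊕ (Fin 3 × Fin p) → ℝ) : Matrix (Fin p) (Fin p) ℝ :=
  fun j i => if h : (i, j) ∈ E then θ (Sum.inl ⟨(i, j), h⟩) else 0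

lemma exists_poly_edge {p : ℕ} {E : Finset (Fin p × Fin p)} (hself : ∀ i : Fin p, (i, i) ∈ E)
    (lt : Fin p → Fin p → Prop) (irr : ∀ a, ¬ lt a a) (u v : Fin p) (huv : lt u v)
    (hE : (u, v) ∈ E) :
    ∃ P : MvPolynomial ({e : Fin p × Fin p // e ∈ E} ⊕ (Fin 3 × Fin p)) ℝ, P ≠ 0 ∧
      ∀ θ, PowDecay (paramMat θ) → MvPolynomial.eval θ P ≠ 0 →
        (sysMat lt u v (paramMat θ) (fun i => θ (Sum.inr (0, i)))
          (fun i => θ (Sum.inr (1, i)))).det ≠ 0 := by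
  classical
  let S : Set ({e : Fin p × Fin p // e ∈ E} ⊕ (Fin 3 × Fin p) → ℝ) := {θ | PowDecay (paramMat θ)}
  have hA : ∀ i j, IsRat S fun θ => paramMat θ i j := by
    intro i j
    unfold paramMat
    by_cases h : (j, i) ∈ E
    · simp only [h, dif_pos]
      exact IsRat.coord _
    · simp only [h]
      exact IsRat.const 0
  have hR : IsRat S fun θ => (sysMat lt u v (paramMat θ) (fun i => θ (Sum.inr (0, i)))
          (fun i => θ (Sum.inr (1, i)))).det := by
    refine IsRat.det fun j k => ?_
    unfold sysMat
    split_ifs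
    · exact IsRat.cumulant (fun θ h => h) hA (fun i => IsRat.coord _) _
    · exact IsRat.cumulant (fun θ h => h) hA (fun i => IsRat.coord _) _
    · exact IsRat.const _
    · exact IsRat.const _
  let θ₀ : {e : Fin p × Fin p // e ∈ E} ⊕ (Fin 3 × Fin p) → ℝ :=
    Sum.elim (fun e => testMat u v e.1.2 e.1.1) (fun _ => 1)
  have hθ : paramMat θ₀ = testMat u v := by
    ext j i
    unfold paramMat
    by_cases h : (i, j) ∈ E
    · simp [h, θ₀]
    · rw [dif_neg h]
      unfold testMat
      split_ifs with h1 h2 h3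
      · subst h1 h2; exact absurd (hself _) h
      · subst h1 h3; exact absurd hE h
      · rfl
      · rfl
  refine hR.exists_poly (θ₀ := θ₀) ?_ ?_
  · change PowDecay (paramMat θ₀)
    rw [hθ]; exact testMat_decay u v
  · rw [hθ]
    exact testMat_det lt irr u v huv

/-- Generic identifiability of discrete Lyapunov models for DAGs with
all self-loops and no isolated nodes, from second-, third- and fourth-order cumulants. -/
theorem stmt_6 (p : ℕ) (hp : 2 ≤ p) (E : Finset (Fin p × Fin p))
    (hself : ∀ i : Fin p, (i, i) ∈ E)
    (hdag : ∃ lt : Fin p → Fin p → Prop, IsStrictTotalOrder (Fin p) lt ∧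
      ∀ i j : Fin p, (i, j) ∈ E → i ≠ j → lt i j)
    (hnoiso : ∀ i : Fin p, ∃ j : Fin p, j ≠ i ∧ ((i, j) ∈ E ∨ (j, i) ∈ E)) :
    ∃ q : MvPolynomial ({e : Fin p × Fin p // e ∈ E} ⊕ (Fin 3 × Fin p)) ℝ,
      q ≠ 0 ∧
      ∀ (A : Matrix (Fin p) (Fin p) ℝ) (w₂ w₃ w₄ : Fin p → ℝ),
        (∀ i j : Fin p, (i, j) ∉ E → A j i = 0) →
        (∀ μ ∈ spectrum ℂ (A.map (algebraMap ℝ ℂ)), ‖μ‖ < 1) →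
        (∀ i : Fin p, A i i ≠ 0) →
        (∀ i : Fin p, 0 < w₂ i) → (∀ i : Fin p, w₃ i ≠ 0) → (∀ i : Fin p, 0 < w₄ i) →
        MvPolynomial.eval
          (Sum.elim (fun e : {e : Fin p × Fin p // e ∈ E} => A e.1.2 e.1.1)
            (fun ki : Fin 3 × Fin p => ![w₂, w₃, w₄] ki.1 ki.2)) q ≠ 0 →
        ∀ (A' : Matrix (Fin p) (Fin p) ℝ) (w₂' w₃' w₄' : Fin p → ℝ),
          (∀ i j : Fin p, (i, j) ∉ E → A' j i = 0) →
          (∀ μ ∈ spectrum ℂ (A'.map (algebraMap ℝ ℂ)), ‖μ‖ < 1) →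
          (∀ i : Fin p, A' i i ≠ 0) →
          (∀ i : Fin p, 0 < w₂' i) → (∀ i : Fin p, w₃' i ≠ 0) → (∀ i : Fin p, 0 < w₄' i) →
          steadyCumulant p 2 A w₂ = steadyCumulant p 2 A' w₂' →
          steadyCumulant p 3 A w₃ = steadyCumulant p 3 A' w₃' →
          steadyCumulant p 4 A w₄ = steadyCumulant p 4 A' w₄' →
          A = A' := by
  classical
  obtain ⟨lt, hlt, hE⟩ := hdag
  have irr : ∀ a, ¬ lt a a := fun a => irrefl_of lt a
  have tr : ∀ a b c, lt a b → lt b c → lt a c := fun a b c => trans_of lt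
  have tri : ∀ a b, lt a b ∨ a = b ∨ lt b a := fun a b => trichotomous_of lt a b
  have wf : WellFounded lt := Finite.wellFounded_of_trans_of_irrefl lt
  have hex : ∀ e : {e : Fin p × Fin p // e ∈ E}, ∃ P : MvPolynomial
      ({e : Fin p × Fin p // e ∈ E} ⊕ (Fin 3 × Fin p)) ℝ, P ≠ 0 ∧ (e.1.1 ≠ e.1.2 →
      ∀ θ, PowDecay (paramMat θ) → MvPolynomial.eval θ P ≠ 0 →
        (sysMat lt e.1.1 e.1.2 (paramMat θ) (fun i => θ (Sum.inr (0, i)))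
          (fun i => θ (Sum.inr (1, i)))).det ≠ 0) := by
    intro e
    by_cases h : e.1.1 = e.1.2
    · exact ⟨1, one_ne_zero, fun h' => absurd h h'⟩
    · obtain ⟨P, h1, h2⟩ := exists_poly_edge hself lt irr e.1.1 e.1.2 (hE _ _ e.2 h) e.2
      exact ⟨P, h1, fun _ => h2⟩
  choose P hP0 hP using hex
  refine ⟨∏ e, MvPolynomial.X (Sum.inl e) * P e, ?_, ?_⟩
  · exact Finset.prod_ne_zero_iff.2 fun e _ => mul_ne_zero (MvPolynomial.X_ne_zero _) (hP0 e)
  intro A w₂ w₃ w₄ hsup hspec hdiag hw₂ hw₃ hw₄ hq A' w₂' w₃' w₄' hsup' hspec' hdiag' hw₂' hw₃' hw₄'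
    hT2 hT3 hT4
  set θ : {e : Fin p × Fin p // e ∈ E} ⊕ (Fin 3 × Fin p) → ℝ :=
    Sum.elim (fun e : {e : Fin p × Fin p // e ∈ E} => A e.1.2 e.1.1)
      (fun ki : Fin 3 × Fin p => ![w₂, w₃, w₄] ki.1 ki.2) with hθ
  have hpar : paramMat θ = A := by
    ext j i
    unfold paramMat
    by_cases h : (i, j) ∈ E
    · simp [h, hθ]
    · simp [h, hsup i j h]
  rw [map_prod, Finset.prod_ne_zero_iff] at hq
  have hA := powDecay_of_spectrum A hspec
  have hA' := powDecay_of_spectrum A' hspec'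
  have hedge : ∀ u v, (u, v) ∈ E → A v u ≠ 0 := by
    intro u v h
    have := hq ⟨(u, v), h⟩ (Finset.mem_univ _)
    rw [map_mul, MvPolynomial.eval_X] at this
    exact left_ne_zero_of_mul this
  have hdet : ∀ u v, (u, v) ∈ E → u ≠ v → (sysMat lt u v A w₂ w₃).det ≠ 0 := by
    intro u v h huv
    have := hq ⟨(u, v), h⟩ (Finset.mem_univ _)
    rw [map_mul] at this
    have h2 := hP ⟨(u, v), h⟩ huv θ (by rw [hpar]; exact hA) (right_ne_zero_of_mul this)
    rw [hpar] at h2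
    exact h2
  have htri : ∀ i j, A j i ≠ 0 → i ≠ j → lt i j := fun i j h hij =>
    hE i j (by by_contra h'; exact h (hsup i j h')) hij
  have htri' : ∀ i j, A' j i ≠ 0 → i ≠ j → lt i j := fun i j h hij =>
    hE i j (by by_contra h'; exact h (hsup' i j h')) hij
  have main : ∀ v, A v = A' v := by
    intro v
    induction v using wf.induction with
    | _ v ih =>
    by_cases hpa : ∃ u, u ≠ v ∧ (u, v) ∈ E
    · obtain ⟨u, huv, huE⟩ := hpa
      have hluv := hE u v huE huv
      by_contra hne
      refine hdet u v huE huv (Matrix.exists_mulVec_eq_zero_iff.1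
        ⟨fun k => A v k - A' v k, ?_, ?_⟩)
      · intro h0
        exact hne (funext fun k => sub_eq_zero.1 (congrFun h0 k))
      · funext j
        change ∑ k, sysMat lt u v A w₂ w₃ j k * (A v k - A' v k) = 0
        unfold sysMat
        by_cases h1 : lt j v
        · simp only [h1, if_true]
          rw [← row_diff (n := 0) wf irr htri hdiag tr hA hA' w₂ w₂' hT2 v ih (fun _ => j)
            (fun _ => h1)]
          exact Finset.sum_congr rfl fun k _ => mul_comm _ _
        by_cases h2 : j = v
        · simp only [h1, h2, irr, if_true, if_false]
          rw [← row_diff (n := 1) wf irr htri hdiag tr hA hA' w₃ w₃' hT3 v ih (fun _ => u)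
            (fun _ => hluv)]
          exact Finset.sum_congr rfl fun k _ => mul_comm _ _
        · have hnE : (j, v) ∉ E := fun h => h1 (hE j v h h2)
          simp [h1, h2, hsup j v hnE, hsup' j v hnE]
    · push Not at hpa
      have hu : ∀ r, r ≠ v → A v r = 0 := fun r hr => hsup r v (hpa r hr)
      have hu' : ∀ r, r ≠ v → A' v r = 0 := fun r hr => hsup' r v (hpa r hr)
      have hch : {c | c ≠ v ∧ (v, c) ∈ E}.Nonempty := by
        obtain ⟨j, hj, h | h⟩ := hnoiso v
        · exact ⟨j, hj, h⟩
        · exact absurd h (hpa j hj)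
      obtain ⟨c, ⟨hc1, hc2⟩, hmin⟩ := wf.has_min _ hch
      have hno : ∀ k, lt k c → k ≠ v → (v, k) ∉ E := fun k hk hkv h => hmin k ⟨hkv, h⟩ hk
      have hvv : A v v = A' v v := by
        refine root_ident wf tri tr htri htri' hA hA' ![w₂, w₃, w₄] ![w₂', w₃', w₄'] v c hc1.symm
          hu hu' (fun k hk hkv => hsup _ _ (hno k hk hkv)) (fun k hk hkv => hsup' _ _ (hno k hk hkv))
          (hdiag v) (hdiag' v) (hedge v c hc2) ?_ ?_ ?_
        · intro n; fin_cases n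
          · exact (hw₂ v).ne'
          · exact hw₃ v
          · exact (hw₄ v).ne'
        · intro n; fin_cases n
          · exact (hw₂' v).ne'
          · exact hw₃' v
          · exact (hw₄' v).ne'
        · intro n; fin_cases n
          · exact hT2
          · exact hT3
          · exact hT4
      funext r
      by_cases hr : r = v
      · rw [hr, hvv]
      · rw [hu r hr, hu' r hr]
  exact funext main
end

section
/- Let p ≥ 2 and let E be an edge set on V = {0,…,p−1} such that: (a) for i ≠ j, not both (i,j) ∈ E and (j,i) ∈ E; (b) the simple graph on V with adjacency i ∼ j iff i ≠ j and ((i,j) ∈ E or (j,i) ∈ E) is a tree (so the off-diagonal edges form a polytree with no isolated nodes); (c) (i,i) ∈ E for every source i, where a vertex i is a source if there is no j ≠ i with (j,i) ∈ E. Let Θ be the set of tuples θ = (A, w₂, w₃, w₄) where A is an E-supported Schur stable real p×p matrix with A_{ii} ≠ 0 for every source i, and w₂, w₃, w₄ : V → ℝ are respectively entrywise positive, entrywise nonzero, and entrywise positive; identify θ with the point of ℝ^{|E|+3p} recording the entries (A_{ji})_{(i,j)∈E} together with the values of w₂, w₃, w₄. Then there exists a polynomial q in the |E|+3p parameter coordinates,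 not the zero polynomial, such that for every θ = (A,w₂,w₃,w₄) ∈ Θ with q(θ) ≠ 0 and every θ′ = (A′,w₂′,w₃′,w₄′) ∈ Θ, if T₂(A,w₂) = T₂(A′,w₂′), T₃(A,w₃) = T₃(A′,w₃′) and T₄(A,w₄) = T₄(A′,w₄′), then A = A′. -/
open Matrix

/-- Directed off-diagonal edge relation. -/
def edgeRel {p : ℕ} (E : Finset (Fin p × Fin p)) (i j : Fin p) : Prop := i ≠ j ∧ (i, j) ∈ E

section analytic

attribute [local instance] Matrix.linftyOpNormedRing Matrix.linftyOpNormedAlgebra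

theorem summable_pow_entry {p : ℕ} (A : Matrix (Fin p) (Fin p) ℝ)
    (hA : ∀ μ ∈ spectrum ℂ (A.map (algebraMap ℝ ℂ)), ‖μ‖ < 1) (i j : Fin p) :
    Summable (fun l : ℕ => ‖(A ^ l) i j‖) := by
  haveI : Nonempty (Fin p) := ⟨i⟩
  set B := A.map (algebraMap ℝ ℂ) with hB
  have h1 : spectralRadius ℂ B < ((1 : NNReal) : ENNReal) := by
    apply spectrum.spectralRadius_lt_of_forall_lt
    intro z hz
    exact_mod_cast hA z hz
  obtain ⟨r, hr1, hr2⟩ := ENNReal.lt_iff_exists_nnreal_btwn.mp h1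
  have h2 := spectrum.pow_nnnorm_pow_one_div_tendsto_nhds_spectralRadius B
  have h3 := h2.eventually (gt_mem_nhds hr1)
  have hr3 : (r : ℝ) < 1 := by exact_mod_cast hr2
  refine Summable.of_norm_bounded_eventually_nat
    (g := fun l => (r : ℝ) ^ l) (summable_geometric_of_lt_one r.2 hr3) ?_
  filter_upwards [h3, Filter.eventually_gt_atTop 0] with l hl hl0
  have h4 : (‖B ^ l‖₊ : ENNReal) < (r : ENNReal) ^ l := by
    have hl' : (l : ℝ) ≠ 0 := by exact_mod_cast hl0.ne'
    have := ENNReal.rpow_lt_rpow hl (z := (l : ℝ)) (by exact_mod_cast hl0)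
    rwa [← ENNReal.rpow_mul, one_div, inv_mul_cancel₀ hl', ENNReal.rpow_one,
      ENNReal.rpow_natCast] at this
  have h5 : ‖B ^ l‖₊ < r ^ l := by exact_mod_cast h4
  have h6 : ‖(B ^ l) i j‖₊ ≤ ‖B ^ l‖₊ := by
    rw [Matrix.linfty_opNNNorm_def]
    refine le_trans ?_ (Finset.le_sup (f := fun i => ∑ j, ‖(B ^ l) i j‖₊) (Finset.mem_univ i))
    exact Finset.single_le_sum (f := fun j => ‖(B ^ l) i j‖₊) (fun _ _ => zero_le)
      (Finset.mem_univ j)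
  have h7 : (B ^ l) i j = (((A ^ l) i j : ℝ) : ℂ) := by
    have : B ^ l = (A ^ l).map (algebraMap ℝ ℂ) := by
      rw [hB]; exact (map_pow (algebraMap ℝ ℂ).mapMatrix A l).symm
    rw [this]; rfl
  have h8 : ‖(A ^ l) i j‖ = ‖(B ^ l) i j‖ := by rw [h7, Complex.norm_real]
  rw [norm_norm, h8]
  have : ‖(B ^ l) i j‖₊ ≤ r ^ l := h6.trans h5.le
  exact_mod_cast this

end analytic

theorem pow_row_source {p : ℕ} {A : Matrix (Fin p) (Fin p) ℝ} {s : Fin p}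
    (hs : ∀ k, k ≠ s → A s k = 0) (l : ℕ) (r : Fin p) :
    (A ^ l) s r = if r = s then A s s ^ l else 0 := by
  induction l generalizing r with
  | zero => simp [Matrix.one_apply, eq_comm]
  | succ l ih =>
    rw [pow_succ', Matrix.mul_apply, Finset.sum_eq_single s]
    · rw [ih]; split_ifs <;> simp [pow_succ']
    · intro k _ hk; rw [hs k hk, zero_mul]
    · simp

theorem abs_lt_one_source {p : ℕ} {A : Matrix (Fin p) (Fin p) ℝ} {s : Fin p}
    (hA : ∀ μ ∈ spectrum ℂ (A.map (algebraMap ℝ ℂ)), ‖μ‖ < 1)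
    (hs : ∀ k, k ≠ s → A s k = 0) : |A s s| < 1 := by
  have h := summable_pow_entry A hA s s
  simp only [pow_row_source hs, if_true, norm_pow] at h
  have := summable_geometric_iff_norm_lt_one.mp h
  simpa using this

/-- The cumulant with one index `v` and `m` indices `s`. -/
noncomputable def mixedCum {p : ℕ} (A : Matrix (Fin p) (Fin p) ℝ) (w : Fin p → ℝ) (s : Fin p)
    (m : ℕ) (v : Fin p) : ℝ :=
  steadyCumulant p (m + 1) A w (Fin.cons v (fun _ => s))

theorem mixedCum_eq {p : ℕ} {A : Matrix (Fin p) (Fin p) ℝ} {s : Fin p} (w : Fin p → ℝ)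
    (hs : ∀ k, k ≠ s → A s k = 0) (m : ℕ) (hm : m ≠ 0) (v : Fin p) :
    mixedCum A w s m v = ∑' l : ℕ, w s * (A s s ^ m) ^ l * (A ^ l) v s := by
  unfold mixedCum steadyCumulant
  congr 1; ext l
  rw [Finset.sum_eq_single s]
  · rw [Fin.prod_univ_succ]
    simp [pow_row_source hs, ← pow_mul, mul_comm l m]; ring
  · intro r _ hr
    rw [Fin.prod_univ_succ]
    simp [pow_row_source hs, hr, hm]
  · simp

theorem mixedCum_summable {p : ℕ} {A : Matrix (Fin p) (Fin p) ℝ} {s : Fin p} (w : Fin p → ℝ)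
    (hA : ∀ μ ∈ spectrum ℂ (A.map (algebraMap ℝ ℂ)), ‖μ‖ < 1)
    (hs : ∀ k, k ≠ s → A s k = 0) (m : ℕ) (v : Fin p) :
    Summable (fun l : ℕ => w s * (A s s ^ m) ^ l * (A ^ l) v s) := by
  have h := (summable_pow_entry A hA v s).mul_left ‖w s‖
  refine Summable.of_norm_bounded h ?_
  intro l
  rw [norm_mul, norm_mul]
  have h1 : ‖(A s s ^ m) ^ l‖ ≤ 1 := by
    rw [norm_pow, norm_pow]
    have := (abs_lt_one_source hA hs).le
    exact pow_le_one₀ (by positivity) (pow_le_one₀ (by positivity) (by simpa using this))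
  have : ‖w s‖ * ‖(A s s ^ m) ^ l‖ ≤ ‖w s‖ := mul_le_of_le_one_right (norm_nonneg _) h1
  gcongr

theorem mixedCum_rec {p : ℕ} {A : Matrix (Fin p) (Fin p) ℝ} {s : Fin p} (w : Fin p → ℝ)
    (hA : ∀ μ ∈ spectrum ℂ (A.map (algebraMap ℝ ℂ)), ‖μ‖ < 1)
    (hs : ∀ k, k ≠ s → A s k = 0) (m : ℕ) (hm : m ≠ 0) (v : Fin p) :
    mixedCum A w s m v =
      (if v = s then w s else 0) + A s s ^ m * ∑ k, A v k * mixedCum A w s m k := by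
  rw [mixedCum_eq w hs m hm, (mixedCum_summable w hA hs m v).tsum_eq_zero_add]
  congr 1
  · simp [Matrix.one_apply]
  · simp only [mixedCum_eq w hs m hm]
    rw [Finset.mul_sum]
    simp only [← tsum_mul_left]
    rw [← Summable.tsum_finsetSum]
    · congr 1; ext l
      rw [pow_succ' A, Matrix.mul_apply, Finset.mul_sum]
      refine Finset.sum_congr rfl fun k _ => ?_
      ring
    · intro k _
      exact ((mixedCum_summable w hA hs m k).mul_left _).mul_left _

theorem tree_lower_unique {V : Type*} {G : SimpleGraph V} (hG : G.IsTree) {s b c u : V}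
    (hb : G.Adj b c) (hu : G.Adj u c) (h1 : G.dist s c = G.dist s b + 1)
    (h2 : G.dist s c = G.dist s u + 1) : b = u := by
  obtain ⟨P, hP⟩ := hG.connected.exists_walk_length_eq_dist s b
  obtain ⟨Q, hQ⟩ := hG.connected.exists_walk_length_eq_dist s u
  have hP' : (P.concat hb).IsPath :=
    SimpleGraph.Walk.isPath_of_length_eq_dist _ (by rw [SimpleGraph.Walk.length_concat]; omega)
  have hQ' : (Q.concat hu).IsPath :=
    SimpleGraph.Walk.isPath_of_length_eq_dist _ (by rw [SimpleGraph.Walk.length_concat]; omega)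
  have h := congrArg Subtype.val (hG.isAcyclic.path_unique ⟨_, hP'⟩ ⟨_, hQ'⟩)
  have h' := congrArg SimpleGraph.Walk.penultimate h
  simpa using h'

section graph

variable {p : ℕ} {E : Finset (Fin p × Fin p)}

theorem edgeRel_adj {i j : Fin p} (h : edgeRel E i j) :
    (SimpleGraph.fromRel (fun i j : Fin p => (i, j) ∈ E)).Adj i j := by
  rw [SimpleGraph.fromRel_adj]; exact ⟨h.1, Or.inl h.2⟩

theorem dist_step (hno2cycle : ∀ i j : Fin p, i ≠ j → ¬((i, j) ∈ E ∧ (j, i) ∈ E))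
    (htree : (SimpleGraph.fromRel (fun i j : Fin p => (i, j) ∈ E)).IsTree)
    {s v : Fin p} (hv : Relation.ReflTransGen (edgeRel E) s v) :
    ∀ u, edgeRel E v u →
      (SimpleGraph.fromRel (fun i j : Fin p => (i, j) ∈ E)).dist s u =
      (SimpleGraph.fromRel (fun i j : Fin p => (i, j) ∈ E)).dist s v + 1 := by
  induction hv with
  | refl =>
    intro u hu
    rw [SimpleGraph.dist_self, SimpleGraph.dist_eq_one_iff_adj.mpr (edgeRel_adj hu)]
  | @tail b c _ hbc ih =>
    intro u hu
    have h1 := ih c hbc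
    have hne := htree.dist_ne_of_adj s (edgeRel_adj hu)
    have hd := (edgeRel_adj hu).diff_dist_adj (u := s)
    by_contra hcon
    have h2 : (SimpleGraph.fromRel (fun i j : Fin p => (i, j) ∈ E)).dist s c =
      (SimpleGraph.fromRel (fun i j : Fin p => (i, j) ∈ E)).dist s u + 1 := by omega
    have := tree_lower_unique htree (edgeRel_adj hbc) (edgeRel_adj hu).symm h1 h2
    subst this
    exact hno2cycle b c hbc.1 ⟨hbc.2, hu.2⟩

theorem parent_unique (hno2cycle : ∀ i j : Fin p, i ≠ j → ¬((i, j) ∈ E ∧ (j, i) ∈ E))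
    (htree : (SimpleGraph.fromRel (fun i j : Fin p => (i, j) ∈ E)).IsTree)
    {s i k j : Fin p} (hi : Relation.ReflTransGen (edgeRel E) s i)
    (hk : Relation.ReflTransGen (edgeRel E) s k)
    (hij : edgeRel E i j) (hkj : edgeRel E k j) : i = k :=
  tree_lower_unique htree (edgeRel_adj hij) (edgeRel_adj hkj)
    (dist_step hno2cycle htree hi j hij) (dist_step hno2cycle htree hk j hkj)

theorem exists_source (hno2cycle : ∀ i j : Fin p, i ≠ j → ¬((i, j) ∈ E ∧ (j, i) ∈ E))
    (htree : (SimpleGraph.fromRel (fun i j : Fin p => (i, j) ∈ E)).IsTree) (v : Fin p) :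
    ∃ s, (¬∃ j, j ≠ s ∧ (j, s) ∈ E) ∧ Relation.ReflTransGen (edgeRel E) s v := by
  have hirr : Std.Irrefl (Relation.TransGen (edgeRel E)) := by
    constructor
    intro a ha
    obtain ⟨b, hb, hba⟩ := Relation.TransGen.tail'_iff.mp ha
    have := dist_step hno2cycle htree hb a hba
    rw [SimpleGraph.dist_self] at this
    omega
  have hwf : WellFounded (Relation.TransGen (edgeRel E)) :=
    Finite.wellFounded_of_trans_of_irrefl _
  induction v using hwf.induction with
  | _ v ih =>
    by_cases h : ∃ j, j ≠ v ∧ (j, v) ∈ E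
    · obtain ⟨j, hj⟩ := h
      obtain ⟨s, hs, hsj⟩ := ih j (Relation.TransGen.single hj)
      exact ⟨s, hs, hsj.tail hj⟩
    · exact ⟨v, h, Relation.ReflTransGen.refl⟩

theorem mixedCum_zero {A : Matrix (Fin p) (Fin p) ℝ} {s : Fin p} (w : Fin p → ℝ)
    (hsupp : ∀ i j : Fin p, (i, j) ∉ E → A j i = 0)
    (hs : ∀ k, k ≠ s → A s k = 0) (m : ℕ) (hm : m ≠ 0) (v : Fin p)
    (hv : ¬ Relation.ReflTransGen (edgeRel E) s v) : mixedCum A w s m v = 0 := by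
  have key : ∀ l : ℕ, ∀ v, ¬ Relation.ReflTransGen (edgeRel E) s v → (A ^ l) v s = 0 := by
    intro l
    induction l with
    | zero =>
      intro v hv
      have : v ≠ s := by rintro rfl; exact hv Relation.ReflTransGen.refl
      simp [Matrix.one_apply, this]
    | succ l ih =>
      intro v hv
      rw [pow_succ', Matrix.mul_apply]
      refine Finset.sum_eq_zero fun k _ => ?_
      by_cases hk : Relation.ReflTransGen (edgeRel E) s k
      · have : (k, v) ∉ E := by
          intro hkv
          by_cases hne : k = v
          · subst hne; exact hv hk
          · exact hv (hk.tail ⟨hne, hkv⟩)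
        rw [hsupp _ _ this, zero_mul]
      · rw [ih k hk, mul_zero]
  rw [mixedCum_eq w hs m hm]
  simp [key _ v hv]

/-- The key recursion along an edge. -/
theorem mixedCum_edge (hno2cycle : ∀ i j : Fin p, i ≠ j → ¬((i, j) ∈ E ∧ (j, i) ∈ E))
    (htree : (SimpleGraph.fromRel (fun i j : Fin p => (i, j) ∈ E)).IsTree)
    {A : Matrix (Fin p) (Fin p) ℝ} {s : Fin p} (w : Fin p → ℝ)
    (hA : ∀ μ ∈ spectrum ℂ (A.map (algebraMap ℝ ℂ)), ‖μ‖ < 1)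
    (hsupp : ∀ i j : Fin p, (i, j) ∉ E → A j i = 0)
    (hsrc : ¬∃ j, j ≠ s ∧ (j, s) ∈ E)
    (m : ℕ) (hm : m ≠ 0) {i j : Fin p} (hi : Relation.ReflTransGen (edgeRel E) s i)
    (hij : edgeRel E i j) :
    mixedCum A w s m j * (1 - A s s ^ m * A j j) = A s s ^ m * A j i * mixedCum A w s m i := by
  have hs : ∀ k, k ≠ s → A s k = 0 := fun k hk => hsupp _ _ fun h => hsrc ⟨k, hk, h⟩
  have hjs : j ≠ s := by rintro rfl; exact hsrc ⟨i, hij⟩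
  have h := mixedCum_rec w hA hs m hm j
  rw [if_neg hjs, ← Finset.sum_subset (Finset.subset_univ {i, j}), Finset.sum_pair hij.1] at h
  · linear_combination h
  · intro k _ hk
    simp only [Finset.mem_insert, Finset.mem_singleton, not_or] at hk
    by_cases hk' : Relation.ReflTransGen (edgeRel E) s k
    · have : (k, j) ∉ E := fun hkj =>
        hk.1 (parent_unique hno2cycle htree hi hk' hij ⟨hk.2, hkj⟩).symm
      rw [hsupp _ _ this, zero_mul]
    · rw [mixedCum_zero w hsupp hs m hm k hk', mul_zero]

theorem mixedCum_ne_zero (hno2cycle : ∀ i j : Fin p, i ≠ j → ¬((i, j) ∈ E ∧ (j, i) ∈ E))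
    (htree : (SimpleGraph.fromRel (fun i j : Fin p => (i, j) ∈ E)).IsTree)
    {A : Matrix (Fin p) (Fin p) ℝ} {s : Fin p} (w : Fin p → ℝ)
    (hA : ∀ μ ∈ spectrum ℂ (A.map (algebraMap ℝ ℂ)), ‖μ‖ < 1)
    (hsupp : ∀ i j : Fin p, (i, j) ∉ E → A j i = 0)
    (hsrc : ¬∃ j, j ≠ s ∧ (j, s) ∈ E) (hw : w s ≠ 0) (hss : A s s ≠ 0)
    (hgen : ∀ i j, edgeRel E i j → A j i ≠ 0)
    (m : ℕ) (hm : m ≠ 0) {i : Fin p} (hi : Relation.ReflTransGen (edgeRel E) s i) :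
    mixedCum A w s m i ≠ 0 := by
  have hs : ∀ k, k ≠ s → A s k = 0 := fun k hk => hsupp _ _ fun h => hsrc ⟨k, hk, h⟩
  induction hi with
  | refl =>
    intro h0
    have h := mixedCum_rec w hA hs m hm s
    rw [Finset.sum_eq_single s (fun k _ hk => by rw [hs k hk, zero_mul]) (by simp), h0] at h
    simp at h
    exact hw h.symm
  | @tail b c hb hbc ih =>
    intro h0
    have h := mixedCum_edge hno2cycle htree w hA hsupp hsrc m hm hb hbc
    rw [h0, zero_mul] at h
    exact mul_ne_zero (mul_ne_zero (pow_ne_zero _ hss) (hgen _ _ hbc)) ih h.symm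

end graph

theorem alg_core {a b c y z : ℝ} {m : ℕ} (ha : a ≠ 0) (hz : z ≠ 0)
    (h : z * (1 - a ^ m * c) = a ^ m * b * y) : a⁻¹ ^ m - c = b * (y / z) := by
  have : a ^ m ≠ 0 := pow_ne_zero _ ha
  rw [inv_pow]
  field_simp
  linear_combination h

theorem alg_bc {t b c b' c' R2 R3 : ℝ} (ht0 : t ≠ 0) (ht1 : t ≠ 1)
    (h2 : t ^ 1 - c = b * R2) (h3 : t ^ 2 - c = b * R3)
    (h2' : t ^ 1 - c' = b' * R2) (h3' : t ^ 2 - c' = b' * R3) : b = b' ∧ c = c' := by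
  have hR : R3 - R2 ≠ 0 := by
    intro h0
    have : t * (t - 1) = 0 := by linear_combination h3 - h2 + b * h0
    exact mul_ne_zero ht0 (sub_ne_zero.mpr ht1) this
  have hb : b = b' := by
    apply mul_right_cancel₀ hR
    linear_combination h2 - h3 - h2' + h3'
  refine ⟨hb, ?_⟩
  subst hb
  linear_combination h2' - h2

theorem alg_a {t b c t' b' c' R2 R3 R4 : ℝ} (ht0 : t ≠ 0) (ht1 : t ≠ 1)
    (ht0' : t' ≠ 0) (ht1' : t' ≠ 1)
    (h2 : t ^ 1 - c = b * R2) (h3 : t ^ 2 - c = b * R3) (h4 : t ^ 3 - c = b * R4)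
    (h2' : t' ^ 1 - c' = b' * R2) (h3' : t' ^ 2 - c' = b' * R3) (h4' : t' ^ 3 - c' = b' * R4) :
    t = t' := by
  have e1 : t * (t - 1) = b * (R3 - R2) := by linear_combination h3 - h2
  have e1' : t' * (t' - 1) = b' * (R3 - R2) := by linear_combination h3' - h2'
  have n1 := mul_ne_zero ht0 (sub_ne_zero.mpr ht1)
  have n1' := mul_ne_zero ht0' (sub_ne_zero.mpr ht1')
  rw [e1] at n1
  rw [e1'] at n1'
  have hR := right_ne_zero_of_mul n1
  have hb := left_ne_zero_of_mul n1
  have hb' := left_ne_zero_of_mul n1'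
  have f : b * (t * (R3 - R2)) = b * (R4 - R3) := by linear_combination h4 - h3 - t * e1
  have f' : b' * (t' * (R3 - R2)) = b' * (R4 - R3) := by linear_combination h4' - h3' - t' * e1'
  have g := mul_left_cancel₀ hb f
  have g' := mul_left_cancel₀ hb' f'
  exact mul_right_cancel₀ hR (g.trans g'.symm)

/-- Generic identifiability of discrete Lyapunov models of polytrees
with self-loops at all sources, from second-, third- and fourth-order cumulants. -/
theorem stmt_7 (p : ℕ) (hp : 2 ≤ p) (E : Finset (Fin p × Fin p))
    (hno2cycle : ∀ i j : Fin p, i ≠ j → ¬((i, j) ∈ E ∧ (j, i) ∈ E))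
    (htree : (SimpleGraph.fromRel (fun i j : Fin p => (i, j) ∈ E)).IsTree)
    (hsrcloop : ∀ i : Fin p, (¬∃ j : Fin p, j ≠ i ∧ (j, i) ∈ E) → (i, i) ∈ E) :
    ∃ q : MvPolynomial ({e : Fin p × Fin p // e ∈ E} ⊕ (Fin 3 × Fin p)) ℝ,
      q ≠ 0 ∧
      ∀ (A : Matrix (Fin p) (Fin p) ℝ) (w₂ w₃ w₄ : Fin p → ℝ),
        (∀ i j : Fin p, (i, j) ∉ E → A j i = 0) →
        (∀ μ ∈ spectrum ℂ (A.map (algebraMap ℝ ℂ)), ‖μ‖ < 1) →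
        (∀ i : Fin p, (¬∃ j : Fin p, j ≠ i ∧ (j, i) ∈ E) → A i i ≠ 0) →
        (∀ i : Fin p, 0 < w₂ i) → (∀ i : Fin p, w₃ i ≠ 0) → (∀ i : Fin p, 0 < w₄ i) →
        MvPolynomial.eval
          (Sum.elim (fun e : {e : Fin p × Fin p // e ∈ E} => A e.1.2 e.1.1)
            (fun ki : Fin 3 × Fin p => ![w₂, w₃, w₄] ki.1 ki.2)) q ≠ 0 →
        ∀ (A' : Matrix (Fin p) (Fin p) ℝ) (w₂' w₃' w₄' : Fin p → ℝ),
          (∀ i j : Fin p, (i, j) ∉ E → A' j i = 0) →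
          (∀ μ ∈ spectrum ℂ (A'.map (algebraMap ℝ ℂ)), ‖μ‖ < 1) →
          (∀ i : Fin p, (¬∃ j : Fin p, j ≠ i ∧ (j, i) ∈ E) → A' i i ≠ 0) →
          (∀ i : Fin p, 0 < w₂' i) → (∀ i : Fin p, w₃' i ≠ 0) → (∀ i : Fin p, 0 < w₄' i) →
          steadyCumulant p 2 A w₂ = steadyCumulant p 2 A' w₂' →
          steadyCumulant p 3 A w₃ = steadyCumulant p 3 A' w₃' →
          steadyCumulant p 4 A w₄ = steadyCumulant p 4 A' w₄' →
          A = A' := by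
  classical
  refine ⟨∏ e : {e : Fin p × Fin p // e ∈ E},
    (if e.1.1 ≠ e.1.2 then MvPolynomial.X (Sum.inl e) else 1), ?_, ?_⟩
  · rw [Finset.prod_ne_zero_iff]
    intro e _
    split_ifs
    · exact MvPolynomial.X_ne_zero _
    · exact one_ne_zero
  intro A w₂ w₃ w₄ hsupp hA hAs hw2 hw3 hw4 hq A' w₂' w₃' w₄' hsupp' hA' hAs' _ _ _ hT2 hT3 hT4
  have hgen : ∀ i j, edgeRel E i j → A j i ≠ 0 := by
    intro i j hij
    rw [map_prod, Finset.prod_ne_zero_iff] at hq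
    have := hq ⟨(i, j), hij.2⟩ (Finset.mem_univ _)
    simpa [hij.1] using this
  have e1 : ∀ s v, mixedCum A w₂ s 1 v = mixedCum A' w₂' s 1 v := fun s v => congrFun hT2 _
  have e2 : ∀ s v, mixedCum A w₃ s 2 v = mixedCum A' w₃' s 2 v := fun s v => congrFun hT3 _
  have e3 : ∀ s v, mixedCum A w₄ s 3 v = mixedCum A' w₄' s 3 v := fun s v => congrFun hT4 _
  -- the inverse self-loop weight at a source is neither zero nor one
  have hinv : ∀ B : Matrix (Fin p) (Fin p) ℝ, (∀ i j : Fin p, (i, j) ∉ E → B j i = 0) →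
      (∀ μ ∈ spectrum ℂ (B.map (algebraMap ℝ ℂ)), ‖μ‖ < 1) →
      ∀ s, (¬∃ j, j ≠ s ∧ (j, s) ∈ E) → (B s s)⁻¹ ≠ 1 := by
    intro B hB1 hB2 s hsrc h
    have := abs_lt_one_source hB2 (s := s) fun k hk => hB1 _ _ fun h => hsrc ⟨k, hk, h⟩
    rw [inv_eq_one.mp h] at this
    simp at this
  have hcore : ∀ (w w' : Fin p → ℝ) (m : ℕ), m ≠ 0 → (∀ i, w i ≠ 0) →
      (∀ s v, mixedCum A w s m v = mixedCum A' w' s m v) →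
      ∀ s, (¬∃ j, j ≠ s ∧ (j, s) ∈ E) → ∀ i j, Relation.ReflTransGen (edgeRel E) s i →
      edgeRel E i j →
      (A s s)⁻¹ ^ m - A j j = A j i * (mixedCum A w s m i / mixedCum A w s m j) ∧
      (A' s s)⁻¹ ^ m - A' j j = A' j i * (mixedCum A w s m i / mixedCum A w s m j) := by
    intro w w' m hm hw he s hsrc i j hi hij
    have hz := mixedCum_ne_zero hno2cycle htree w hA hsupp hsrc (hw s) (hAs s hsrc) hgen m hm
      (hi.tail hij)
    refine ⟨alg_core (hAs s hsrc) hz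
      (mixedCum_edge hno2cycle htree w hA hsupp hsrc m hm hi hij), ?_⟩
    refine alg_core (hAs' s hsrc) hz ?_
    rw [he, he]
    exact mixedCum_edge hno2cycle htree w' hA' hsupp' hsrc m hm hi hij
  have c1 := hcore w₂ w₂' 1 (by norm_num) (fun i => (hw2 i).ne') e1
  have c2 := hcore w₃ w₃' 2 (by norm_num) hw3 e2
  have c3 := hcore w₄ w₄' 3 (by norm_num) (fun i => (hw4 i).ne') e3
  -- bring the ratios of different orders under names via the algebraic lemmas
  have hsource : ∀ s, (¬∃ j, j ≠ s ∧ (j, s) ∈ E) → A s s = A' s s := by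
    intro s hsrc
    haveI : Nontrivial (Fin p) := Fin.nontrivial_iff_two_le.mpr hp
    obtain ⟨j, hj⟩ := htree.connected.preconnected.exists_adj_of_nontrivial s
    rw [SimpleGraph.fromRel_adj] at hj
    have hsj : edgeRel E s j := by
      refine ⟨hj.1, hj.2.resolve_right fun h => hsrc ⟨j, hj.1.symm, h⟩⟩
    obtain ⟨p1, q1⟩ := c1 s hsrc s j Relation.ReflTransGen.refl hsj
    obtain ⟨p2, q2⟩ := c2 s hsrc s j Relation.ReflTransGen.refl hsj
    obtain ⟨p3, q3⟩ := c3 s hsrc s j Relation.ReflTransGen.refl hsj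
    exact inv_injective (alg_a (inv_ne_zero (hAs s hsrc)) (hinv A hsupp hA s hsrc)
      (inv_ne_zero (hAs' s hsrc)) (hinv A' hsupp' hA' s hsrc) p1 p2 p3 q1 q2 q3)
  have hedge : ∀ i j, edgeRel E i j → A j i = A' j i ∧ A j j = A' j j := by
    intro i j hij
    obtain ⟨s, hsrc, hi⟩ := exists_source hno2cycle htree i
    obtain ⟨p1, q1⟩ := c1 s hsrc i j hi hij
    obtain ⟨p2, q2⟩ := c2 s hsrc i j hi hij
    rw [← hsource s hsrc] at q1 q2
    exact alg_bc (inv_ne_zero (hAs s hsrc)) (hinv A hsupp hA s hsrc) p1 p2 q1 q2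
  ext j i
  by_cases hE : (i, j) ∈ E
  · by_cases hij : i = j
    · subst hij
      by_cases hsrc : ∃ k, k ≠ i ∧ (k, i) ∈ E
      · obtain ⟨k, hk⟩ := hsrc
        exact (hedge k i hk).2
      · exact hsource i hsrc
    · exact (hedge i j ⟨hij, hE⟩).1
  · rw [hsupp _ _ hE, hsupp' _ _ hE]
end

section
/- Let p ≥ 3 and let E be an edge set on V = {0,…,p−1} such that (i,i) ∈ E for every i and the skeleton simple graph on V (adjacency i ∼ j iff i ≠ j and ((i,j) ∈ E or (j,i) ∈ E)) is connected. Let Θ be the set of tuples θ = (A, w₂, w₃) where A is an E-supported Schur stable real p×p matrix, w₂ : V → ℝ is entrywise positive and w₃ : V → ℝ is entrywise nonzero; identify θ with the point of ℝ^{|E|+2p} recording the entries (A_{ji})_{(i,j)∈E}, w₂ and w₃. Then there exists a polynomial q in the |E|+2p parameter coordinates, not the zero polynomial, such that every θ ∈ Θ with q(θ) ≠ 0 satisfies: (a) the off-diagonal modified Jacobian of θ has rank exactly |E|; and (b) the set {θ′ ∈ Θ : T₂(A′,w₂′) = T₂(A,w₂) and T₃(A′,w₃′) = T₃(A,w₃)}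 is finite (local identifiability from second- and third-order cumulants). -/
open Matrix

/-- The off-diagonal modified Jacobian of the second- and third-order cumulants:
rows indexed by ordered pairs `(i,j)` with `i ≠ j` and ordered triples `(i,j,k)` not all
equal, columns indexed by the edges `(α,β) ∈ E`. -/
noncomputable def offDiagModJac (p : ℕ) (E : Finset (Fin p × Fin p))
    (A : Matrix (Fin p) (Fin p) ℝ) (S : Fin p → Fin p → ℝ)
    (T : Fin p → Fin p → Fin p → ℝ) :
    Matrix ({x : Fin p × Fin p // x.1 ≠ x.2} ⊕
        {x : Fin p × Fin p × Fin p // ¬(x.1 = x.2.1 ∧ x.2.1 = x.2.2)})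
      {e : Fin p × Fin p // e ∈ E} ℝ :=
  Matrix.of fun r e =>
    match r with
    | Sum.inl ⟨(i, j), _⟩ =>
        (if j = e.1.2 then (1 : ℝ) else 0) * ∑ l : Fin p, A i l * S l e.1.1
          + (if i = e.1.2 then (1 : ℝ) else 0) * ∑ k : Fin p, A j k * S k e.1.1
    | Sum.inr ⟨(i, j, k), _⟩ =>
        (if i = e.1.2 then (1 : ℝ) else 0) *
            ∑ m : Fin p, ∑ n : Fin p, A j m * A k n * T e.1.1 m n
          + (if j = e.1.2 then (1 : ℝ) else 0) *
            ∑ l : Fin p, ∑ n : Fin p, A i l * A k n * T l e.1.1 n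
          + (if k = e.1.2 then (1 : ℝ) else 0) *
            ∑ l : Fin p, ∑ m : Fin p, A i l * A j m * T l m e.1.1

section Gen

variable {p : ℕ} {K K' : Type*} [CommRing K] [CommRing K']

/-- second order steady-state equation over a commutative ring -/
def IsSol2 (A : Fin p → Fin p → K) (w : Fin p → K) (S : Fin p → Fin p → K) : Prop :=
  ∀ i j, S i j = (∑ k, ∑ l, A i k * A j l * S k l) + if i = j then w i else 0

/-- third order steady-state equation over a commutative ring -/
def IsSol3 (A : Fin p → Fin p → K) (w : Fin p → K) (T : Fin p → Fin p → Fin p → K) : Prop :=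
  ∀ i j k, T i j k = (∑ l, ∑ m, ∑ n, A i l * A j m * A k n * T l m n)
    + if i = j ∧ j = k then w i else 0

/-- the matrix of the second order equation -/
def M2 (A : Fin p → Fin p → K) : Matrix (Fin p × Fin p) (Fin p × Fin p) K :=
  1 - Matrix.of fun x y => A x.1 y.1 * A x.2 y.2

/-- the matrix of the third order equation -/
def M3 (A : Fin p → Fin p → K) :
    Matrix (Fin p × Fin p × Fin p) (Fin p × Fin p × Fin p) K :=
  1 - Matrix.of fun x y => A x.1 y.1 * A x.2.1 y.2.1 * A x.2.2 y.2.2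

lemma isSol2_iff (A : Fin p → Fin p → K) (w : Fin p → K) (S : Fin p → Fin p → K) :
    IsSol2 A w S ↔ M2 A *ᵥ (fun x => S x.1 x.2) = fun x => if x.1 = x.2 then w x.1 else 0 := by
  unfold IsSol2 M2
  rw [Matrix.sub_mulVec, Matrix.one_mulVec, funext_iff, Prod.forall]
  refine forall_congr' fun i => forall_congr' fun j => ?_
  simp only [Pi.sub_apply, Matrix.mulVec, dotProduct,
    Matrix.of_apply, Fintype.sum_prod_type]
  rw [sub_eq_iff_eq_add, add_comm]

lemma isSol3_iff (A : Fin p → Fin p → K) (w : Fin p → K) (T : Fin p → Fin p → Fin p → K) :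
    IsSol3 A w T ↔ M3 A *ᵥ (fun x => T x.1 x.2.1 x.2.2) =
      fun x => if x.1 = x.2.1 ∧ x.2.1 = x.2.2 then w x.1 else 0 := by
  unfold IsSol3 M3
  rw [Matrix.sub_mulVec, Matrix.one_mulVec, funext_iff, Prod.forall]
  refine forall_congr' fun i => ?_
  rw [Prod.forall]
  refine forall_congr' fun j => forall_congr' fun k => ?_
  simp only [Pi.sub_apply, Matrix.mulVec, dotProduct,
    Matrix.of_apply, Fintype.sum_prod_type]
  rw [sub_eq_iff_eq_add, add_comm]

lemma mulVec_inj_of_isUnit {n : Type*} [Fintype n] [DecidableEq n] {M : Matrix n n K}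
    (h : IsUnit M.det) {u v : n → K} (huv : M *ᵥ u = M *ᵥ v) : u = v := by
  have := congrArg (fun z => M⁻¹ *ᵥ z) huv
  simpa [Matrix.mulVec_mulVec, Matrix.nonsing_inv_mul _ h] using this

lemma exists_sol2 (A : Fin p → Fin p → K) (w : Fin p → K) (h : IsUnit (M2 A).det) :
    ∃ S, IsSol2 A w S := by
  refine ⟨fun i j => ((M2 A)⁻¹ *ᵥ fun x => if x.1 = x.2 then w x.1 else 0) (i, j), ?_⟩
  rw [isSol2_iff]
  simp only [Prod.mk.eta]
  rw [show (fun x => ((M2 A)⁻¹ *ᵥ fun x => if x.1 = x.2 then w x.1 else 0) x)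
    = ((M2 A)⁻¹ *ᵥ fun x => if x.1 = x.2 then w x.1 else 0) from rfl]
  rw [Matrix.mulVec_mulVec, Matrix.mul_nonsing_inv _ h, Matrix.one_mulVec]

lemma exists_sol3 (A : Fin p → Fin p → K) (w : Fin p → K) (h : IsUnit (M3 A).det) :
    ∃ T, IsSol3 A w T := by
  refine ⟨fun i j k => ((M3 A)⁻¹ *ᵥ
    fun x => if x.1 = x.2.1 ∧ x.2.1 = x.2.2 then w x.1 else 0) (i, j, k), ?_⟩
  rw [isSol3_iff]
  simp only [Prod.mk.eta]
  rw [show (fun x => ((M3 A)⁻¹ *ᵥ fun x => if x.1 = x.2.1 ∧ x.2.1 = x.2.2 then w x.1 else 0) x)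
    = ((M3 A)⁻¹ *ᵥ fun x => if x.1 = x.2.1 ∧ x.2.1 = x.2.2 then w x.1 else 0) from rfl]
  rw [Matrix.mulVec_mulVec, Matrix.mul_nonsing_inv _ h, Matrix.one_mulVec]

lemma IsSol2.unique {A : Fin p → Fin p → K} {w : Fin p → K} {S S' : Fin p → Fin p → K}
    (h : IsUnit (M2 A).det) (hS : IsSol2 A w S) (hS' : IsSol2 A w S') : S = S' := by
  rw [isSol2_iff] at hS hS'
  have := mulVec_inj_of_isUnit h (hS.trans hS'.symm)
  funext i j
  exact congrFun this (i, j)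

lemma IsSol3.unique {A : Fin p → Fin p → K} {w : Fin p → K} {T T' : Fin p → Fin p → Fin p → K}
    (h : IsUnit (M3 A).det) (hT : IsSol3 A w T) (hT' : IsSol3 A w T') : T = T' := by
  rw [isSol3_iff] at hT hT'
  have := mulVec_inj_of_isUnit h (hT.trans hT'.symm)
  funext i j k
  exact congrFun this (i, j, k)

lemma IsSol2.symm {A : Fin p → Fin p → K} {w : Fin p → K} {S : Fin p → Fin p → K}
    (h : IsUnit (M2 A).det) (hS : IsSol2 A w S) (i j : Fin p) : S i j = S j i := by
  have : IsSol2 A w (fun i j => S j i) := by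
    intro i j
    have := hS j i
    simp only [] at this ⊢
    rw [this, Finset.sum_comm]
    congr 1
    · exact Finset.sum_congr rfl fun _ _ => Finset.sum_congr rfl fun _ _ => by ring
    · by_cases hij : i = j
      · simp [hij]
      · simp [hij, Ne.symm hij]
  exact congrFun (congrFun (hS.unique h this) i) j

lemma IsSol2.map (f : K →+* K') {A : Fin p → Fin p → K} {w : Fin p → K} {S : Fin p → Fin p → K}
    (hS : IsSol2 A w S) :
    IsSol2 (fun i j => f (A i j)) (fun i => f (w i)) (fun i j => f (S i j)) := by
  intro i j
  have := congrArg f (hS i j)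
  refine this.trans ?_
  simp only [map_add, map_sum, map_mul, apply_ite f, map_zero]

lemma IsSol3.map (f : K →+* K') {A : Fin p → Fin p → K} {w : Fin p → K}
    {T : Fin p → Fin p → Fin p → K} (hT : IsSol3 A w T) :
    IsSol3 (fun i j => f (A i j)) (fun i => f (w i)) (fun i j k => f (T i j k)) := by
  intro i j k
  have := congrArg f (hT i j k)
  refine this.trans ?_
  simp only [map_add, map_sum, map_mul, apply_ite f, map_zero]

lemma map_det_M2 (f : K →+* K') (A : Fin p → Fin p → K) :
    f (M2 A).det = (M2 fun i j => f (A i j)).det := by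
  rw [RingHom.map_det]
  congr 1
  ext x y
  simp [M2, Matrix.one_apply, apply_ite f]

lemma map_det_M3 (f : K →+* K') (A : Fin p → Fin p → K) :
    f (M3 A).det = (M3 fun i j => f (A i j)).det := by
  rw [RingHom.map_det]
  congr 1
  ext x y
  simp [M3, Matrix.one_apply, apply_ite f]

/-- The modified Jacobian over an arbitrary commutative ring. -/
def genJac (E : Finset (Fin p × Fin p))
    (A : Fin p → Fin p → K) (S : Fin p → Fin p → K)
    (T : Fin p → Fin p → Fin p → K) :
    Matrix ({x : Fin p × Fin p // x.1 ≠ x.2} ⊕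
        {x : Fin p × Fin p × Fin p // ¬(x.1 = x.2.1 ∧ x.2.1 = x.2.2)})
      {e : Fin p × Fin p // e ∈ E} K :=
  Matrix.of fun r e =>
    match r with
    | Sum.inl ⟨(i, j), _⟩ =>
        (if j = e.1.2 then (1 : K) else 0) * ∑ l : Fin p, A i l * S l e.1.1
          + (if i = e.1.2 then (1 : K) else 0) * ∑ k : Fin p, A j k * S k e.1.1
    | Sum.inr ⟨(i, j, k), _⟩ =>
        (if i = e.1.2 then (1 : K) else 0) *
            ∑ m : Fin p, ∑ n : Fin p, A j m * A k n * T e.1.1 m n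
          + (if j = e.1.2 then (1 : K) else 0) *
            ∑ l : Fin p, ∑ n : Fin p, A i l * A k n * T l e.1.1 n
          + (if k = e.1.2 then (1 : K) else 0) *
            ∑ l : Fin p, ∑ m : Fin p, A i l * A j m * T l m e.1.1

lemma genJac_real (E : Finset (Fin p × Fin p)) (A : Matrix (Fin p) (Fin p) ℝ)
    (S : Fin p → Fin p → ℝ) (T : Fin p → Fin p → Fin p → ℝ) :
    offDiagModJac p E A S T = genJac E A S T := by
  ext r e
  rcases r with ⟨⟨i, j⟩, h⟩ | ⟨⟨i, j, k⟩, h⟩ <;> rfl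

lemma genJac_map (E : Finset (Fin p × Fin p)) (f : K →+* K') (A : Fin p → Fin p → K)
    (S : Fin p → Fin p → K) (T : Fin p → Fin p → Fin p → K) :
    (genJac E A S T).map f =
      genJac E (fun i j => f (A i j)) (fun i j => f (S i j)) (fun i j k => f (T i j k)) := by
  ext r e
  rcases r with ⟨⟨i, j⟩, h⟩ | ⟨⟨i, j, k⟩, h⟩ <;>
  simp [genJac, apply_ite f]

/-- The gram determinant of the Jacobian -/
def gramDet (E : Finset (Fin p × Fin p)) (A : Fin p → Fin p → K)
    (S : Fin p → Fin p → K) (T : Fin p → Fin p → Fin p → K) : K :=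
  ((genJac E A S T)ᵀ * genJac E A S T).det

lemma gramDet_map (E : Finset (Fin p × Fin p)) (f : K →+* K') (A : Fin p → Fin p → K)
    (S : Fin p → Fin p → K) (T : Fin p → Fin p → Fin p → K) :
    f (gramDet E A S T) =
      gramDet E (fun i j => f (A i j)) (fun i j => f (S i j)) (fun i j k => f (T i j k)) := by
  unfold gramDet
  rw [RingHom.map_det, ← genJac_map, RingHom.mapMatrix_apply, Matrix.map_mul, Matrix.transpose_map]

/-- Extend a vector indexed by edges to a matrix. -/
def ext0 (E : Finset (Fin p × Fin p)) (v : {e : Fin p × Fin p // e ∈ E} → K) :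
    Fin p → Fin p → K := fun b a => if h : (a, b) ∈ E then v ⟨(a, b), h⟩ else 0

lemma sum_edge (E : Finset (Fin p × Fin p)) (v : {e : Fin p × Fin p // e ∈ E} → K)
    (c : Fin p → K) (j : Fin p) :
    ∑ e : {e : Fin p × Fin p // e ∈ E}, (if j = e.1.2 then (1 : K) else 0) * c e.1.1 * v e
      = ∑ a, ext0 E v j a * c a := by
  have h1 : ∀ e : {e : Fin p × Fin p // e ∈ E},
      (if j = e.1.2 then (1 : K) else 0) * c e.1.1 * v e
       = (fun x : Fin p × Fin p => (if j = x.2 then (1 : K) else 0) * c x.1 * ext0 E v x.2 x.1) e.1 := by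
    rintro ⟨⟨a, b⟩, he⟩
    simp [ext0, he]
  rw [Finset.sum_congr rfl fun e _ => h1 e]
  rw [Finset.sum_coe_sort E
    (fun x : Fin p × Fin p => (if j = x.2 then (1 : K) else 0) * c x.1 * ext0 E v x.2 x.1)]
  rw [Finset.sum_subset (Finset.subset_univ E)]
  · rw [Fintype.sum_prod_type]
    refine Finset.sum_congr rfl fun a _ => ?_
    simp [mul_comm]
  · rintro ⟨a, b⟩ _ he
    simp [ext0, he]

lemma genJac_mulVec_inl (E : Finset (Fin p × Fin p)) (A : Fin p → Fin p → K)
    (S : Fin p → Fin p → K) (T : Fin p → Fin p → Fin p → K)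
    (v : {e : Fin p × Fin p // e ∈ E} → K) (i j : Fin p) (h : (i, j).1 ≠ (i, j).2) :
    (genJac E A S T *ᵥ v) (Sum.inl ⟨(i, j), h⟩) =
      (∑ a, ext0 E v j a * ∑ l, A i l * S l a) + ∑ a, ext0 E v i a * ∑ k, A j k * S k a := by
  rw [← sum_edge, ← sum_edge, ← Finset.sum_add_distrib]
  simp only [Matrix.mulVec, dotProduct, genJac, Matrix.of_apply, add_mul]

lemma genJac_mulVec_inr (E : Finset (Fin p × Fin p)) (A : Fin p → Fin p → K)
    (S : Fin p → Fin p → K) (T : Fin p → Fin p → Fin p → K)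
    (v : {e : Fin p × Fin p // e ∈ E} → K) (i j k : Fin p) (h) :
    (genJac E A S T *ᵥ v) (Sum.inr ⟨(i, j, k), h⟩) =
      (∑ a, ext0 E v i a * ∑ m, ∑ n, A j m * A k n * T a m n)
      + (∑ a, ext0 E v j a * ∑ l, ∑ n, A i l * A k n * T l a n)
      + ∑ a, ext0 E v k a * ∑ l, ∑ m, A i l * A j m * T l m a := by
  rw [← sum_edge, ← sum_edge, ← sum_edge, ← Finset.sum_add_distrib, ← Finset.sum_add_distrib]
  simp only [Matrix.mulVec, dotProduct, genJac, Matrix.of_apply, add_mul]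

lemma ker_of_gramDet [IsDomain K] (E : Finset (Fin p × Fin p)) (A : Fin p → Fin p → K)
    (S : Fin p → Fin p → K) (T : Fin p → Fin p → Fin p → K) (hg : gramDet E A S T ≠ 0)
    (v : {e : Fin p × Fin p // e ∈ E} → K) (hv : genJac E A S T *ᵥ v = 0) : v = 0 := by
  by_contra hne
  apply hg
  unfold gramDet
  rw [← Matrix.exists_mulVec_eq_zero_iff]
  exact ⟨v, hne, by rw [← Matrix.mulVec_mulVec, hv, Matrix.mulVec_zero]⟩

lemma rank_of_gramDet (E : Finset (Fin p × Fin p)) (A : Fin p → Fin p → ℝ)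
    (S : Fin p → Fin p → ℝ) (T : Fin p → Fin p → Fin p → ℝ) (hg : gramDet E A S T ≠ 0) :
    (genJac E A S T).rank = E.card := by
  rw [← Matrix.rank_transpose_mul_self, Matrix.rank_of_isUnit]
  · simp
  · rw [Matrix.isUnit_iff_isUnit_det]
    exact isUnit_iff_ne_zero.mpr hg

end Gen
section Real

lemma sum_mul_sum3 {p : ℕ} (f g h : Fin p → ℝ) :
    (∑ l, f l) * (∑ m, g m) * (∑ n, h n) = ∑ l, ∑ m, ∑ n, f l * g m * h n := by
  rw [Finset.sum_mul_sum, Finset.sum_mul]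
  exact Finset.sum_congr rfl fun l _ => by rw [Finset.sum_mul_sum]

open Filter Topology

attribute [local instance] Matrix.linftyOpNormedRing Matrix.linftyOpNormedAlgebra

lemma schur_decay {p : ℕ} (A : Matrix (Fin p) (Fin p) ℝ)
    (hA : ∀ μ ∈ spectrum ℂ (A.map (algebraMap ℝ ℂ)), ‖μ‖ < 1) :
    ∃ C r : ℝ, 0 ≤ C ∧ 0 ≤ r ∧ r < 1 ∧ ∀ l i j, |(A ^ l) i j| ≤ C * r ^ l := by
  rcases Nat.eq_zero_or_pos p with hp | hp
  · subst hp
    exact ⟨0, 0, le_rfl, le_rfl, one_pos, fun l i => i.elim0⟩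
  have : Nonempty (Fin p) := ⟨⟨0, hp⟩⟩
  set Ac : Matrix (Fin p) (Fin p) ℂ := A.map (algebraMap ℝ ℂ) with hAc
  have h1 : spectralRadius ℂ Ac < (1 : NNReal) :=
    spectrum.spectralRadius_lt_of_forall_lt Ac (fun k hk => by
      have := hA k hk
      rw [← NNReal.coe_lt_coe]; simpa using this)
  obtain ⟨r, hr1, hr2⟩ := ENNReal.lt_iff_exists_nnreal_btwn.mp h1
  have hr2' : (r : ℝ) < 1 := by exact_mod_cast hr2
  have h2 := (spectrum.pow_nnnorm_pow_one_div_tendsto_nhds_spectralRadius Ac).eventually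
    (gt_mem_nhds hr1)
  obtain ⟨N, hN⟩ := eventually_atTop.mp h2
  have h3 : ∀ l, max N 1 ≤ l → ‖Ac ^ l‖ ≤ (r : ℝ) ^ l := by
    intro l hl
    have hlN := hN l (le_trans (le_max_left _ _) hl)
    have hl1 : 1 ≤ l := le_trans (le_max_right _ _) hl
    have hl0 : (0 : ℝ) < l := by exact_mod_cast hl1
    have h4 := ENNReal.rpow_le_rpow hlN.le hl0.le
    rw [← ENNReal.rpow_mul, one_div, inv_mul_cancel₀ hl0.ne', ENNReal.rpow_one,
      ENNReal.rpow_natCast] at h4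
    exact_mod_cast h4
  -- entry bound
  have hent : ∀ l i j, |(A ^ l) i j| ≤ ‖Ac ^ l‖ := by
    intro l i j
    have e1 : (Ac ^ l) i j = (((A ^ l) i j : ℝ) : ℂ) := by
      rw [hAc, ← Matrix.map_pow]
      rfl
    have e2 : ‖(Ac ^ l) i j‖ = |(A ^ l) i j| := by rw [e1]; simp
    rw [← e2, Matrix.linfty_opNorm_def]
    have e3 : ‖(Ac ^ l) i j‖₊ ≤ ∑ j, ‖(Ac ^ l) i j‖₊ :=
      Finset.single_le_sum (f := fun j => ‖(Ac ^ l) i j‖₊) (fun _ _ => bot_le) (Finset.mem_univ j)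
    have e4 := Finset.le_sup (f := fun i => ∑ j, ‖(Ac ^ l) i j‖₊) (Finset.mem_univ i)
    exact_mod_cast e3.trans e4
  by_cases hr0 : (r : ℝ) = 0
  · -- enlarge r to 1/2
    have h5 : ∀ l, max N 1 ≤ l → ‖Ac ^ l‖ ≤ (1/2 : ℝ) ^ l := fun l hl =>
      (h3 l hl).trans (by rw [hr0]; gcongr; norm_num)
    refine ⟨∑ l ∈ Finset.range (max N 1), ‖Ac ^ l‖ / (1/2)^l + 1, 1/2, by positivity, by norm_num, by norm_num, ?_⟩
    intro l i j
    refine (hent l i j).trans ?_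
    by_cases hl : max N 1 ≤ l
    · refine (h5 l hl).trans ?_
      refine le_mul_of_one_le_left (by positivity) ?_
      have : 0 ≤ ∑ l ∈ Finset.range (max N 1), ‖Ac ^ l‖ / (1/2 : ℝ)^l := by positivity
      linarith
    · have h6 : ‖Ac ^ l‖ / (1/2 : ℝ)^l ≤ ∑ l ∈ Finset.range (max N 1), ‖Ac ^ l‖ / (1/2 : ℝ)^l :=
        Finset.single_le_sum (f := fun l => ‖Ac ^ l‖ / (1/2 : ℝ)^l) (fun _ _ => by positivity)
          (Finset.mem_range.mpr (not_le.mp hl))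
      rw [← div_le_iff₀ (by positivity)]
      linarith
  · have hrp : (0 : ℝ) < r := lt_of_le_of_ne r.2 (Ne.symm hr0)
    refine ⟨∑ l ∈ Finset.range (max N 1), ‖Ac ^ l‖ / (r : ℝ)^l + 1, r, by positivity, hrp.le, hr2', ?_⟩
    intro l i j
    refine (hent l i j).trans ?_
    by_cases hl : max N 1 ≤ l
    · refine (h3 l hl).trans ?_
      refine le_mul_of_one_le_left (by positivity) ?_
      have : 0 ≤ ∑ l ∈ Finset.range (max N 1), ‖Ac ^ l‖ / (r : ℝ)^l := by positivity
      linarith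
    · have h6 : ‖Ac ^ l‖ / (r : ℝ)^l ≤ ∑ l ∈ Finset.range (max N 1), ‖Ac ^ l‖ / (r : ℝ)^l :=
        Finset.single_le_sum (f := fun l => ‖Ac ^ l‖ / (r : ℝ)^l) (fun _ _ => by positivity)
          (Finset.mem_range.mpr (not_le.mp hl))
      rw [← div_le_iff₀ (by positivity)]
      linarith

lemma schur_pow_tendsto {p : ℕ} (A : Matrix (Fin p) (Fin p) ℝ)
    (hA : ∀ μ ∈ spectrum ℂ (A.map (algebraMap ℝ ℂ)), ‖μ‖ < 1) (i j : Fin p) :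
    Tendsto (fun l => (A ^ l) i j) atTop (𝓝 0) := by
  obtain ⟨C, r, hC, hr0, hr1, h⟩ := schur_decay A hA
  have : Tendsto (fun l => C * r ^ l) atTop (𝓝 0) := by
    simpa using (tendsto_pow_atTop_nhds_zero_of_lt_one hr0 hr1).const_mul C
  exact squeeze_zero_norm (fun l => h l i j) this

lemma schur_summable2 {p : ℕ} (A : Matrix (Fin p) (Fin p) ℝ)
    (hA : ∀ μ ∈ spectrum ℂ (A.map (algebraMap ℝ ℂ)), ‖μ‖ < 1) (w : Fin p → ℝ) (i j : Fin p) :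
    Summable (fun l => ∑ r : Fin p, w r * ((A ^ l) i r * (A ^ l) j r)) := by
  obtain ⟨C, r, hC, hr0, hr1, h⟩ := schur_decay A hA
  refine summable_sum fun s _ => Summable.mul_left _ ?_
  refine Summable.of_norm_bounded (g := fun l => C * C * r ^ l)
    ((summable_geometric_of_lt_one hr0 hr1).mul_left _) fun l => ?_
  rw [norm_mul]
  have h1 := h l i s
  have h2 := h l j s
  have h3 : r ^ l ≤ 1 := pow_le_one₀ hr0 hr1.le
  have h4 : C * r ^ l ≤ C := mul_le_of_le_one_right hC h3
  calc _ ≤ (C * r ^ l) * C := mul_le_mul h1 (h2.trans h4) (abs_nonneg _) (by positivity)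
    _ = _ := by ring

lemma schur_summable3 {p : ℕ} (A : Matrix (Fin p) (Fin p) ℝ)
    (hA : ∀ μ ∈ spectrum ℂ (A.map (algebraMap ℝ ℂ)), ‖μ‖ < 1) (w : Fin p → ℝ) (i j k : Fin p) :
    Summable (fun l => ∑ r : Fin p, w r * ((A ^ l) i r * (A ^ l) j r * (A ^ l) k r)) := by
  obtain ⟨C, r, hC, hr0, hr1, h⟩ := schur_decay A hA
  refine summable_sum fun s _ => Summable.mul_left _ ?_
  refine Summable.of_norm_bounded (g := fun l => C * C * C * r ^ l)
    ((summable_geometric_of_lt_one hr0 hr1).mul_left _) fun l => ?_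
  rw [norm_mul, norm_mul]
  have h1 := h l i s
  have h2 := h l j s
  have h2' := h l k s
  have h3 : r ^ l ≤ 1 := pow_le_one₀ hr0 hr1.le
  have h4 : C * r ^ l ≤ C := mul_le_of_le_one_right hC h3
  calc _ ≤ (C * r ^ l) * C * C := mul_le_mul (mul_le_mul h1 (h2.trans h4) (abs_nonneg _) (by positivity))
            (h2'.trans h4) (abs_nonneg _) (by positivity)
    _ = _ := by ring

lemma steady2 {p : ℕ} (A : Matrix (Fin p) (Fin p) ℝ)
    (hA : ∀ μ ∈ spectrum ℂ (A.map (algebraMap ℝ ℂ)), ‖μ‖ < 1) (w : Fin p → ℝ) :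
    IsSol2 (fun i j => A i j) w (fun i j => steadyCumulant p 2 A w ![i, j]) := by
  have hd : ∀ i j, steadyCumulant p 2 A w ![i, j] =
      ∑' l : ℕ, ∑ r : Fin p, w r * ((A ^ l) i r * (A ^ l) j r) := by
    intro i j
    simp [steadyCumulant, Fin.prod_univ_two]
  intro i j
  simp only [hd]
  rw [(schur_summable2 A hA w i j).tsum_eq_zero_add, add_comm]
  congr 1
  · have hs : HasSum (fun b : ℕ => ∑ k, ∑ l, A i k * A j l * ∑ r, w r * ((A ^ b) k r * (A ^ b) l r))
        (∑ k, ∑ l, A i k * A j l * ∑' b : ℕ, ∑ r, w r * ((A ^ b) k r * (A ^ b) l r)) :=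
      hasSum_sum fun k _ => hasSum_sum fun l _ => (schur_summable2 A hA w k l).hasSum.mul_left _
    rw [← hs.tsum_eq]
    refine tsum_congr fun b => ?_
    simp_rw [pow_succ', Matrix.mul_apply, Finset.sum_mul_sum, Finset.mul_sum]
    rw [Finset.sum_comm]
    refine Finset.sum_congr rfl fun k _ => ?_
    rw [Finset.sum_comm]
    refine Finset.sum_congr rfl fun l _ => Finset.sum_congr rfl fun r _ => by ring
  · by_cases hij : i = j
    · subst hij
      simp [Matrix.one_apply]
    · rw [if_neg hij]
      refine Finset.sum_eq_zero fun r _ => ?_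
      by_cases hir : i = r
      · have : j ≠ r := fun h => hij (hir.trans h.symm)
        simp [Matrix.one_apply, this]
      · simp [Matrix.one_apply, hir]

lemma steady3 {p : ℕ} (A : Matrix (Fin p) (Fin p) ℝ)
    (hA : ∀ μ ∈ spectrum ℂ (A.map (algebraMap ℝ ℂ)), ‖μ‖ < 1) (w : Fin p → ℝ) :
    IsSol3 (fun i j => A i j) w (fun i j k => steadyCumulant p 3 A w ![i, j, k]) := by
  have hd : ∀ i j k, steadyCumulant p 3 A w ![i, j, k] =
      ∑' l : ℕ, ∑ r : Fin p, w r * ((A ^ l) i r * (A ^ l) j r * (A ^ l) k r) := by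
    intro i j k
    simp [steadyCumulant, Fin.prod_univ_three]
  intro i j k
  simp only [hd]
  rw [(schur_summable3 A hA w i j k).tsum_eq_zero_add, add_comm]
  congr 1
  · have hs : HasSum (fun b : ℕ => ∑ l, ∑ m, ∑ n, A i l * A j m * A k n *
          ∑ r, w r * ((A ^ b) l r * (A ^ b) m r * (A ^ b) n r))
        (∑ l, ∑ m, ∑ n, A i l * A j m * A k n *
          ∑' b : ℕ, ∑ r, w r * ((A ^ b) l r * (A ^ b) m r * (A ^ b) n r)) :=
      hasSum_sum fun l _ => hasSum_sum fun m _ => hasSum_sum fun n _ =>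
        (schur_summable3 A hA w l m n).hasSum.mul_left _
    rw [← hs.tsum_eq]
    refine tsum_congr fun b => ?_
    simp_rw [pow_succ', Matrix.mul_apply, sum_mul_sum3, Finset.mul_sum]
    rw [Finset.sum_comm]
    refine Finset.sum_congr rfl fun l _ => ?_
    rw [Finset.sum_comm]
    refine Finset.sum_congr rfl fun m _ => ?_
    rw [Finset.sum_comm]
    refine Finset.sum_congr rfl fun n _ => Finset.sum_congr rfl fun r _ => by ring
  · by_cases hij : i = j ∧ j = k
    · obtain ⟨h1, h2⟩ := hij
      subst h1 h2
      simp [Matrix.one_apply]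
    · rw [if_neg hij]
      refine Finset.sum_eq_zero fun r _ => ?_
      by_cases hir : i = r
      · by_cases hjr : j = r
        · have : k ≠ r := fun h => hij ⟨hir.trans hjr.symm, hjr.trans h.symm⟩
          simp [Matrix.one_apply, this]
        · simp [Matrix.one_apply, hjr]
      · simp [Matrix.one_apply, hir]

/-- a fixed vector of a matrix whose powers tend to zero vanishes -/
lemma fixed_zero {n : Type*} [Fintype n] [DecidableEq n] (M : Matrix n n ℝ)
    (hM : ∀ i j, Tendsto (fun l => (M ^ l) i j) atTop (𝓝 0)) (v : n → ℝ) (hv : M *ᵥ v = v) :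
    v = 0 := by
  have h1 : ∀ l : ℕ, (M ^ l) *ᵥ v = v := by
    intro l
    induction l with
    | zero => simp
    | succ l ih => rw [pow_succ, ← Matrix.mulVec_mulVec, hv, ih]
  funext i
  have h2 : Tendsto (fun l : ℕ => ∑ j, (M ^ l) i j * v j) atTop (𝓝 (∑ j, 0 * v j)) :=
    tendsto_finsetSum _ fun j _ => (hM i j).mul_const _
  have h3 : (fun l : ℕ => ∑ j, (M ^ l) i j * v j) = fun _ => v i := by
    funext l
    exact congrFun (h1 l) i
  rw [h3] at h2
  simpa using tendsto_nhds_unique tendsto_const_nhds h2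

lemma det_ne_of_pow {n : Type*} [Fintype n] [DecidableEq n] (M : Matrix n n ℝ)
    (hM : ∀ i j, Tendsto (fun l => (M ^ l) i j) atTop (𝓝 0)) : (1 - M).det ≠ 0 := by
  intro h
  obtain ⟨v, hv0, hv⟩ := Matrix.exists_mulVec_eq_zero_iff.mpr h
  rw [Matrix.sub_mulVec, Matrix.one_mulVec, sub_eq_zero] at hv
  exact hv0 (fixed_zero M hM v hv.symm)

lemma det_M2_ne {p : ℕ} (A : Matrix (Fin p) (Fin p) ℝ)
    (hA : ∀ μ ∈ spectrum ℂ (A.map (algebraMap ℝ ℂ)), ‖μ‖ < 1) :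
    (M2 fun i j => A i j).det ≠ 0 := by
  have hpow : ∀ l : ℕ, (Matrix.of fun x y : Fin p × Fin p => A x.1 y.1 * A x.2 y.2) ^ l =
      Matrix.of fun x y : Fin p × Fin p => (A ^ l) x.1 y.1 * (A ^ l) x.2 y.2 := by
    intro l
    induction l with
    | zero =>
      ext x y
      rw [pow_zero, pow_zero]
      simp only [Matrix.of_apply, Matrix.one_apply, Prod.ext_iff]
      split_ifs <;> simp_all
    | succ l ih =>
      rw [pow_succ, ih]
      ext x y
      simp only [Matrix.of_apply, Matrix.mul_apply, pow_succ, Finset.sum_mul_sum,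
        Fintype.sum_prod_type]
      exact Finset.sum_congr rfl fun _ _ => Finset.sum_congr rfl fun _ _ => by ring
  refine det_ne_of_pow _ fun x y => ?_
  simp only [hpow, Matrix.of_apply]
  simpa using (schur_pow_tendsto A hA x.1 y.1).mul (schur_pow_tendsto A hA x.2 y.2)

lemma det_M3_ne {p : ℕ} (A : Matrix (Fin p) (Fin p) ℝ)
    (hA : ∀ μ ∈ spectrum ℂ (A.map (algebraMap ℝ ℂ)), ‖μ‖ < 1) :
    (M3 fun i j => A i j).det ≠ 0 := by
  have hpow : ∀ l : ℕ, (Matrix.of fun x y : Fin p × Fin p × Fin p =>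
        A x.1 y.1 * A x.2.1 y.2.1 * A x.2.2 y.2.2) ^ l =
      Matrix.of fun x y : Fin p × Fin p × Fin p =>
        (A ^ l) x.1 y.1 * (A ^ l) x.2.1 y.2.1 * (A ^ l) x.2.2 y.2.2 := by
    intro l
    induction l with
    | zero =>
      ext x y
      rw [pow_zero, pow_zero]
      simp only [Matrix.of_apply, Matrix.one_apply, Prod.ext_iff]
      split_ifs <;> simp_all
    | succ l ih =>
      rw [pow_succ, ih]
      ext x y
      simp only [Matrix.of_apply, Matrix.mul_apply, pow_succ, sum_mul_sum3,
        Fintype.sum_prod_type]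
      exact Finset.sum_congr rfl fun _ _ => Finset.sum_congr rfl fun _ _ =>
        Finset.sum_congr rfl fun _ _ => by ring
  refine det_ne_of_pow _ fun x y => ?_
  simp only [hpow, Matrix.of_apply]
  simpa using ((schur_pow_tendsto A hA x.1 y.1).mul (schur_pow_tendsto A hA x.2.1 y.2.1)).mul
    (schur_pow_tendsto A hA x.2.2 y.2.2)

end Real
section PS

open PowerSeries

lemma ps_coeff_zero_mul (f g : ℝ⟦X⟧) : coeff 0 (f * g) = coeff 0 f * coeff 0 g := by
  simp

lemma ps_coeff_one_mul (f g : ℝ⟦X⟧) :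
    coeff 1 (f * g) = coeff 0 f * coeff 1 g + coeff 1 f * coeff 0 g := by
  rw [coeff_mul, Finset.Nat.sum_antidiagonal_eq_sum_range_succ_mk]
  simp [Finset.sum_range_succ]

lemma ps_coeff_two_mul (f g : ℝ⟦X⟧) :
    coeff 2 (f * g) = coeff 0 f * coeff 2 g + coeff 1 f * coeff 1 g + coeff 2 f * coeff 0 g := by
  rw [coeff_mul, Finset.Nat.sum_antidiagonal_eq_sum_range_succ_mk]
  simp [Finset.sum_range_succ]

variable {p : ℕ}

/-- the curve through minus one half of the identity in direction `B` -/
noncomputable def Aps (B : Fin p → Fin p → ℝ) (i j : Fin p) : ℝ⟦X⟧ :=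
  C (if i = j then -1/2 else 0) + X * C (B i j)

lemma Aps_c0 (B : Fin p → Fin p → ℝ) (i j : Fin p) :
    coeff 0 (Aps B i j) = if i = j then -1/2 else 0 := by
  simp only [Aps, map_add, ps_coeff_zero_mul]; simp
lemma Aps_c1 (B : Fin p → Fin p → ℝ) (i j : Fin p) : coeff 1 (Aps B i j) = B i j := by
  simp only [Aps, map_add, ps_coeff_one_mul]; simp [coeff_C, coeff_X]
lemma Aps_c2 (B : Fin p → Fin p → ℝ) (i j : Fin p) : coeff 2 (Aps B i j) = 0 := by
  simp only [Aps, map_add, ps_coeff_two_mul]; simp [coeff_C, coeff_X]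

section lin
variable (B : Fin p → Fin p → ℝ)

lemma lin1_c0 (j : Fin p) (f : Fin p → ℝ⟦X⟧) :
    coeff 0 (∑ m, Aps B j m * f m) = -1/2 * coeff 0 (f j) := by
  simp only [map_sum, ps_coeff_zero_mul, Aps_c0]; simp
lemma lin1_c1 (j : Fin p) (f : Fin p → ℝ⟦X⟧) :
    coeff 1 (∑ m, Aps B j m * f m) = -1/2 * coeff 1 (f j) + ∑ m, B j m * coeff 0 (f m) := by
  simp only [map_sum, ps_coeff_one_mul, Aps_c0, Aps_c1, Finset.sum_add_distrib]; simp
lemma lin1_c2 (j : Fin p) (f : Fin p → ℝ⟦X⟧) :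
    coeff 2 (∑ m, Aps B j m * f m) = -1/2 * coeff 2 (f j) + ∑ m, B j m * coeff 1 (f m) := by
  simp only [map_sum, ps_coeff_two_mul, Aps_c0, Aps_c1, Aps_c2, Finset.sum_add_distrib]; simp

lemma lin2_eq (j k : Fin p) (f : Fin p → Fin p → ℝ⟦X⟧) :
    ∑ m, ∑ n, Aps B j m * Aps B k n * f m n = ∑ m, Aps B j m * ∑ n, Aps B k n * f m n := by
  simp only [Finset.mul_sum, mul_assoc]

lemma lin2_c0 (j k : Fin p) (f : Fin p → Fin p → ℝ⟦X⟧) :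
    coeff 0 (∑ m, ∑ n, Aps B j m * Aps B k n * f m n) = 1/4 * coeff 0 (f j k) := by
  rw [lin2_eq, lin1_c0, lin1_c0]; ring
lemma lin2_c1 (j k : Fin p) (f : Fin p → Fin p → ℝ⟦X⟧) :
    coeff 1 (∑ m, ∑ n, Aps B j m * Aps B k n * f m n) = 1/4 * coeff 1 (f j k)
      - 1/2 * ((∑ m, B j m * coeff 0 (f m k)) + ∑ n, B k n * coeff 0 (f j n)) := by
  rw [lin2_eq, lin1_c1, lin1_c1]
  simp only [lin1_c0]
  have : ∑ m, B j m * (-1/2 * coeff 0 (f m k)) = -1/2 * ∑ m, B j m * coeff 0 (f m k) := by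
    rw [Finset.mul_sum]; exact Finset.sum_congr rfl fun _ _ => by ring
  rw [this]; ring
lemma lin2_c2 (j k : Fin p) (f : Fin p → Fin p → ℝ⟦X⟧) :
    coeff 2 (∑ m, ∑ n, Aps B j m * Aps B k n * f m n) = 1/4 * coeff 2 (f j k)
      - 1/2 * ((∑ m, B j m * coeff 1 (f m k)) + ∑ n, B k n * coeff 1 (f j n))
      + ∑ m, B j m * ∑ n, B k n * coeff 0 (f m n) := by
  rw [lin2_eq, lin1_c2, lin1_c2]
  simp only [lin1_c1, mul_add, Finset.sum_add_distrib]
  have : ∑ m, B j m * (-1/2 * coeff 1 (f m k)) = -1/2 * ∑ m, B j m * coeff 1 (f m k) := by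
    rw [Finset.mul_sum]; exact Finset.sum_congr rfl fun _ _ => by ring
  rw [this]; ring

lemma lin3_eq (i j k : Fin p) (f : Fin p → Fin p → Fin p → ℝ⟦X⟧) :
    ∑ l, ∑ m, ∑ n, Aps B i l * Aps B j m * Aps B k n * f l m n
      = ∑ l, Aps B i l * ∑ m, ∑ n, Aps B j m * Aps B k n * f l m n := by
  simp only [Finset.mul_sum, mul_assoc]
lemma lin3_c0 (i j k : Fin p) (f : Fin p → Fin p → Fin p → ℝ⟦X⟧) :
    coeff 0 (∑ l, ∑ m, ∑ n, Aps B i l * Aps B j m * Aps B k n * f l m n)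
      = -1/8 * coeff 0 (f i j k) := by
  rw [lin3_eq, lin1_c0, lin2_c0]; ring
lemma lin3_c1 (i j k : Fin p) (f : Fin p → Fin p → Fin p → ℝ⟦X⟧) :
    coeff 1 (∑ l, ∑ m, ∑ n, Aps B i l * Aps B j m * Aps B k n * f l m n)
      = -1/8 * coeff 1 (f i j k) + 1/4 * ((∑ l, B i l * coeff 0 (f l j k))
        + (∑ m, B j m * coeff 0 (f i m k)) + ∑ n, B k n * coeff 0 (f i j n)) := by
  rw [lin3_eq, lin1_c1, lin2_c1]
  simp only [lin2_c0]
  have : ∑ m, B i m * (1/4 * coeff 0 (f m j k)) = 1/4 * ∑ m, B i m * coeff 0 (f m j k) := by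
    rw [Finset.mul_sum]; exact Finset.sum_congr rfl fun _ _ => by ring
  rw [this]; ring
lemma lin3_c2 (i j k : Fin p) (f : Fin p → Fin p → Fin p → ℝ⟦X⟧) :
    coeff 2 (∑ l, ∑ m, ∑ n, Aps B i l * Aps B j m * Aps B k n * f l m n)
      = -1/8 * coeff 2 (f i j k) + 1/4 * ((∑ l, B i l * coeff 1 (f l j k))
        + (∑ m, B j m * coeff 1 (f i m k)) + ∑ n, B k n * coeff 1 (f i j n))
        - 1/2 * ((∑ m, B j m * ∑ n, B k n * coeff 0 (f i m n))
          + (∑ l, B i l * ∑ m, B j m * coeff 0 (f l m k))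
          + (∑ l, B i l * ∑ n, B k n * coeff 0 (f l j n))) := by
  rw [lin3_eq, lin1_c2, lin2_c2]
  simp only [lin2_c1]
  have : ∑ m, B i m * (1/4 * coeff 1 (f m j k) - 1/2 * ((∑ m', B j m' * coeff 0 (f m m' k))
      + ∑ n, B k n * coeff 0 (f m j n))) = 1/4 * (∑ m, B i m * coeff 1 (f m j k))
      - 1/2 * ((∑ l, B i l * ∑ m, B j m * coeff 0 (f l m k))
          + (∑ l, B i l * ∑ n, B k n * coeff 0 (f l j n))) := by
    rw [Finset.mul_sum, ← Finset.sum_add_distrib, Finset.mul_sum, ← Finset.sum_sub_distrib]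
    exact Finset.sum_congr rfl fun _ _ => by ring
  rw [this]; ring

end lin

lemma sum_c0 (f g : Fin p → ℝ⟦X⟧) :
    coeff 0 (∑ α, f α * g α) = ∑ α, coeff 0 (f α) * coeff 0 (g α) := by
  simp only [map_sum, ps_coeff_zero_mul]
lemma sum_c1 (f g : Fin p → ℝ⟦X⟧) :
    coeff 1 (∑ α, f α * g α) = (∑ α, coeff 0 (f α) * coeff 1 (g α))
      + ∑ α, coeff 1 (f α) * coeff 0 (g α) := by
  simp only [map_sum, ps_coeff_one_mul, Finset.sum_add_distrib]
lemma sum_c2 (f g : Fin p → ℝ⟦X⟧) :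
    coeff 2 (∑ α, f α * g α) = (∑ α, coeff 0 (f α) * coeff 2 (g α))
      + (∑ α, coeff 1 (f α) * coeff 1 (g α)) + ∑ α, coeff 2 (f α) * coeff 0 (g α) := by
  simp only [map_sum, ps_coeff_two_mul, Finset.sum_add_distrib]

lemma pull_quarter (f g : Fin p → ℝ) : ∑ α, f α * (1/4 * g α) = 1/4 * ∑ α, f α * g α := by
  rw [Finset.mul_sum]; exact Finset.sum_congr rfl fun _ _ => by ring
lemma pull_half (f g : Fin p → ℝ) : ∑ α, f α * (-1/2 * g α) = -1/2 * ∑ α, f α * g α := by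
  rw [Finset.mul_sum]; exact Finset.sum_congr rfl fun _ _ => by ring

lemma ps_kernel (E : Finset (Fin p × Fin p)) (B : Fin p → Fin p → ℝ)
    (S : Fin p → Fin p → ℝ⟦X⟧) (T : Fin p → Fin p → Fin p → ℝ⟦X⟧)
    (hS : IsSol2 (Aps B) (fun _ => C (3/4)) S) (hT : IsSol3 (Aps B) (fun _ => C (9/8)) T)
    (hconn : (SimpleGraph.fromRel (fun i j : Fin p => (i, j) ∈ E)).Connected)
    (hB0 : ∀ i, B i i = 0)
    (hBor : ∀ i j, i ≠ j → (i, j) ∈ E →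
      (B i j = 1 ∧ B j i = 0) ∨ (B j i = 1 ∧ B i j = 0))
    (i₀ k₀ j₀ : Fin p) (hij : i₀ ≠ j₀) (hkj : k₀ ≠ j₀) (hb1 : B i₀ j₀ = 1) (hb2 : B k₀ j₀ = 1)
    (hb3 : B j₀ i₀ = 0) (hb4 : B j₀ k₀ = 0) (hE : i₀ = k₀ → (i₀, j₀) ∉ E)
    (v : {e : Fin p × Fin p // e ∈ E} → ℝ⟦X⟧) (hv : genJac E (Aps B) S T *ᵥ v = 0) :
    ∀ e, coeff 0 (v e) = 0 := by
  -- coefficients of T and S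
  have hT0 : ∀ i j k, coeff 0 (T i j k) = if i = j ∧ j = k then 1 else 0 := by
    intro i j k
    have := congrArg (coeff 0) (hT i j k)
    rw [map_add, lin3_c0] at this
    split_ifs at this ⊢ <;> simp at this ⊢ <;> linarith
  have hT1 : ∀ i j k, 9/8 * coeff 1 (T i j k) = 1/4 * ((∑ l, B i l * coeff 0 (T l j k))
        + (∑ m, B j m * coeff 0 (T i m k)) + ∑ n, B k n * coeff 0 (T i j n)) := by
    intro i j k
    have := congrArg (coeff 1) (hT i j k)
    rw [map_add, lin3_c1] at this
    have h0 : coeff 1 (if i = j ∧ j = k then (C (9/8 : ℝ) : ℝ⟦X⟧) else 0) = 0 := by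
      split_ifs <;> simp
    rw [h0] at this
    linarith
  have hT2 : ∀ i j k, 9/8 * coeff 2 (T i j k) = 1/4 * ((∑ l, B i l * coeff 1 (T l j k))
        + (∑ m, B j m * coeff 1 (T i m k)) + ∑ n, B k n * coeff 1 (T i j n))
        - 1/2 * ((∑ m, B j m * ∑ n, B k n * coeff 0 (T i m n))
          + (∑ l, B i l * ∑ m, B j m * coeff 0 (T l m k))
          + (∑ l, B i l * ∑ n, B k n * coeff 0 (T l j n))) := by
    intro i j k
    have := congrArg (coeff 2) (hT i j k)
    rw [map_add, lin3_c2] at this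
    have h0 : coeff 2 (if i = j ∧ j = k then (C (9/8 : ℝ) : ℝ⟦X⟧) else 0) = 0 := by
      split_ifs <;> simp
    rw [h0] at this
    linarith
  have hS0 : ∀ i j, coeff 0 (S i j) = if i = j then 1 else 0 := by
    intro i j
    have := congrArg (coeff 0) (hS i j)
    rw [map_add, lin2_c0] at this
    split_ifs at this ⊢ <;> simp at this ⊢ <;> linarith
  have hS1 : ∀ i j, 3/4 * coeff 1 (S i j) = -1/2 * (B i j + B j i) := by
    intro i j
    have := congrArg (coeff 1) (hS i j)
    rw [map_add, lin2_c1] at this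
    have h0 : coeff 1 (if i = j then (C (3/4 : ℝ) : ℝ⟦X⟧) else 0) = 0 := by
      split_ifs <;> simp
    rw [h0] at this
    simp only [hS0] at this
    simp at this
    linarith
  -- the matrix of the kernel vector
  set a := ext0 E v with ha
  have hrow2 : ∀ i j, i ≠ j → (∑ α, a j α * ∑ l, Aps B i l * S l α)
      + (∑ α, a i α * ∑ k, Aps B j k * S k α) = 0 := by
    intro i j h
    rw [← genJac_mulVec_inl E (Aps B) S T v i j h, hv]; rfl
  have hrow3 : ∀ i j k, ¬ (i = j ∧ j = k) →
      (∑ α, a i α * ∑ m, ∑ n, Aps B j m * Aps B k n * T α m n)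
      + (∑ α, a j α * ∑ l, ∑ n, Aps B i l * Aps B k n * T l α n)
      + (∑ α, a k α * ∑ l, ∑ m, Aps B i l * Aps B j m * T l m α) = 0 := by
    intro i j k h
    rw [← genJac_mulVec_inr E (Aps B) S T v i j k h, hv]; rfl
  -- contraction with the leading tensor
  have c1 : ∀ (f : Fin p → ℝ) j k, ∑ l, f l * coeff 0 (T l j k) = if j = k then f j else 0 := by
    intro f j k
    simp only [hT0]
    rw [Finset.sum_eq_single j]
    · simp
    · intro b _ hb; simp [hb]
    · simp
  have c2 : ∀ (f : Fin p → ℝ) i k, ∑ l, f l * coeff 0 (T i l k) = if i = k then f i else 0 := by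
    intro f i k
    simp only [hT0]
    rw [Finset.sum_eq_single i]
    · simp
    · intro b _ hb; simp [hb.symm]
    · simp
  have c3 : ∀ (f : Fin p → ℝ) i j, ∑ l, f l * coeff 0 (T i j l) = if i = j then f j else 0 := by
    intro f i j
    simp only [hT0]
    rw [Finset.sum_eq_single j]
    · simp
    · intro b _ hb; simp [hb.symm]
    · simp
  -- order zero
  have ha0 : ∀ i j, i ≠ j → coeff 0 (a i j) = 0 := by
    intro i j h
    have := congrArg (coeff 0) (hrow3 i j j (fun hh => h hh.1))
    simp only [map_add, sum_c0, lin2_c0, pull_quarter, c1, c2, c3, if_neg h, map_zero] at this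
    simpa using this
  set x : Fin p → ℝ := fun i => coeff 0 (a i i) with hx
  have ha0' : ∀ i j, coeff 0 (a i j) = if i = j then x i else 0 := by
    intro i j
    split_ifs with h
    · rw [h]
    · exact ha0 i j h
  have cx : ∀ (f : Fin p → ℝ) i, ∑ α, coeff 0 (a i α) * f α = x i * f i := by
    intro f i
    simp [ha0']
  have hT1' : ∀ i j, i ≠ j → coeff 1 (T i j j) = 2/9 * B i j := by
    intro i j h
    have := hT1 i j j
    simp only [c1, c2, c3, if_neg h, if_true] at this
    linarith
  -- order one, triples
  have ha1 : ∀ i j, i ≠ j → coeff 1 (a i j) = B i j * (4 * x j - 2/9 * (x i + 2 * x j)) := by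
    intro i j h
    have := congrArg (coeff 1) (hrow3 i j j (fun hh => h hh.1))
    simp only [map_add, sum_c1, lin2_c0, lin2_c1, pull_quarter, c1, c2, c3, cx, if_neg h, map_zero,
      hT1' i j h, if_true] at this
    linarith
  -- order one, pairs
  have hpair : ∀ i j, i ≠ j → (coeff 1 (a i j) + coeff 1 (a j i)) * (-1/2)
      + x j * B i j + x i * B j i - 1/2 * (x i + x j) * coeff 1 (S i j) = 0 := by
    intro i j h
    have h1 := congrArg (coeff 1) (hrow2 i j h)
    have hs : coeff 1 (S j i) = coeff 1 (S i j) := by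
      have e1 := hS1 i j
      have e2 := hS1 j i
      linarith
    have s1 : ∀ (f : Fin p → ℝ) i, ∑ l, f l * coeff 0 (S l i) = f i := by
      intro f i; simp [hS0]
    have s2 : ∀ (f : Fin p → ℝ) i, ∑ l, f l * coeff 0 (S i l) = f i := by
      intro f i; simp [hS0]
    simp only [map_add, sum_c1 (fun α => a _ α), lin1_c0, lin1_c1, pull_half, cx, s1, s2, hs,
      map_zero] at h1
    linarith
  have hxx : ∀ i j, i ≠ j → (i, j) ∈ E → x i = x j := by
    intro i j h he
    have e1 := hpair i j h
    have e2 := hS1 i j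
    have e3 := ha1 i j h
    have e4 := ha1 j i h.symm
    rcases hBor i j h he with ⟨b1, b2⟩ | ⟨b1, b2⟩
    · simp only [b1, b2] at e1 e2 e3 e4
      have e5 : coeff 1 (S i j) = -2/3 := by linarith
      rw [e5, e3, e4] at e1
      linarith
    · simp only [b1, b2] at e1 e2 e3 e4
      have e5 : coeff 1 (S i j) = -2/3 := by linarith
      rw [e5, e3, e4] at e1
      linarith
  have hadj : ∀ i j, (SimpleGraph.fromRel (fun i j : Fin p => (i, j) ∈ E)).Adj i j → x i = x j := by
    intro i j h
    rw [SimpleGraph.fromRel_adj] at h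
    rcases h with ⟨h1, h2 | h2⟩
    · exact hxx i j h1 h2
    · exact (hxx j i h1.symm h2).symm
  have hall : ∀ i j, x i = x j := by
    intro i j
    obtain ⟨w⟩ := hconn.preconnected i j
    induction w with
    | nil => rfl
    | cons h _ ih => exact (hadj _ _ h).trans ih
  -- order two
  set y := x i₀ with hy
  have hxy : ∀ i, x i = y := fun i => hall i i₀
  have ha1' : ∀ i j, coeff 1 (a i j) = 10/3 * y * B i j + if i = j then coeff 1 (a i i) else 0 := by
    intro i j
    by_cases h : i = j
    · subst h; simp [hB0]
    · rw [ha1 i j h, if_neg h, hxy, hxy]; ring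
  have ca1 : ∀ (f : Fin p → ℝ) i, ∑ α, coeff 1 (a i α) * f α
      = 10/3 * y * (∑ α, B i α * f α) + coeff 1 (a i i) * f i := by
    intro f i
    have : ∀ α, coeff 1 (a i α) * f α
        = 10/3 * y * (B i α * f α) + if i = α then coeff 1 (a i i) * f i else 0 := by
      intro α
      rw [ha1' i α]
      by_cases h : i = α
      · subst h; simp [hB0]
      · simp [h]; ring
    rw [Finset.sum_congr rfl fun α _ => this α, Finset.sum_add_distrib, ← Finset.mul_sum]
    simp
  have pull3 : ∀ (b f g h : Fin p → ℝ), ∑ α, b α * (1/4 * f α - 1/2 * (g α + h α))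
      = 1/4 * (∑ α, b α * f α) - 1/2 * ((∑ α, b α * g α) + ∑ α, b α * h α) := by
    intro b f g h
    rw [← Finset.sum_add_distrib, Finset.mul_sum, Finset.mul_sum, ← Finset.sum_sub_distrib]
    exact Finset.sum_congr rfl fun _ _ => by ring
  have hT1z : coeff 1 (T i₀ k₀ j₀) = 0 := by
    have := hT1 i₀ k₀ j₀
    simp only [c1, c2, c3, if_neg hij, if_neg hkj, hb4, ite_self] at this
    linarith
  have ha2 : (if i₀ = k₀ then coeff 2 (a j₀ k₀) else 0) = 0 := by
    split_ifs with h
    · have : a j₀ k₀ = 0 := by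
        rw [ha, ← h]; simp [ext0, hE h]
      rw [this]; simp
    · rfl
  have hrow := congrArg (coeff 2) (hrow3 i₀ k₀ j₀ (fun hh => hkj hh.2))
  have h2 := hT2 i₀ k₀ j₀
  simp only [map_add, sum_c2, lin2_c0, lin2_c1, lin2_c2, pull_quarter, cx, ca1, pull3, c1, c2, c3,
    hT1z, hxy, if_neg hij, if_neg hkj, hb1, hb2, hb3, hb4, hB0, ha2, ite_self, mul_ite, mul_zero,
    mul_one, zero_mul, Finset.sum_ite_eq, Finset.sum_ite_eq', Finset.mem_univ, if_true, map_zero,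
    add_zero, zero_add, sub_zero] at hrow h2
  have hsp : ∑ α, B i₀ α * (1 / 4 * coeff 1 (T α k₀ j₀) - if α = j₀ then 1 / 2 * B k₀ α else 0)
      = 1/4 * (∑ α, B i₀ α * coeff 1 (T α k₀ j₀)) - 1/2 := by
    have : ∀ α, B i₀ α * (1 / 4 * coeff 1 (T α k₀ j₀) - if α = j₀ then 1 / 2 * B k₀ α else 0)
        = 1/4 * (B i₀ α * coeff 1 (T α k₀ j₀)) - if α = j₀ then 1/2 else 0 := by
      intro α
      split_ifs with h
      · rw [h, hb1, hb2]; ring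
      · ring
    rw [Finset.sum_congr rfl fun α _ => this α, Finset.sum_sub_distrib, ← Finset.mul_sum]
    simp
  rw [hsp] at hrow
  rw [Finset.sum_const_zero] at h2
  have hy0 : y = 0 := by
    linear_combination (-3/8) * hrow + (1/4) * y * h2
  rintro ⟨⟨α, β⟩, he⟩
  have h1 := ha0' β α
  have h2 : a β α = v ⟨(α, β), he⟩ := by simp [ha, ext0, he]
  rw [h2, hxy, hy0, ite_self] at h1
  exact h1

end PS
section PS2

open PowerSeries

lemma ps_sq_zero {ι : Type*} [Fintype ι] (n : ℕ) : ∀ (f : ι → ℝ⟦X⟧), ∑ i, f i * f i = 0 →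
    ∀ i, coeff n (f i) = 0 := by
  have h0 : ∀ (f : ι → ℝ⟦X⟧), ∑ i, f i * f i = 0 → ∀ i, coeff 0 (f i) = 0 := by
    intro f hf i
    have := congrArg (coeff 0) hf
    simp only [map_sum, ps_coeff_zero_mul, map_zero] at this
    have h2 := (Finset.sum_eq_zero_iff_of_nonneg
      (fun i _ => mul_self_nonneg (coeff 0 (f i)))).1 this i (Finset.mem_univ i)
    exact mul_self_eq_zero.1 h2
  induction n with
  | zero => exact h0
  | succ n ih =>
    intro f hf i
    have hd : ∀ i, ∃ g, f i = X * g := by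
      intro i
      have : (X : ℝ⟦X⟧) ∣ f i := by
        rw [X_dvd_iff, ← coeff_zero_eq_constantCoeff_apply]; exact h0 f hf i
      exact this
    choose g hg using hd
    have hgs : ∑ i, g i * g i = 0 := by
      have : (X * X : ℝ⟦X⟧) * ∑ i, g i * g i = 0 := by
        rw [Finset.mul_sum, ← hf]
        exact Finset.sum_congr rfl fun i _ => by rw [hg i]; ring
      rcases mul_eq_zero.1 this with h | h
      · exact absurd h (mul_ne_zero X_ne_zero X_ne_zero)
      · exact h
    rw [hg i, coeff_succ_X_mul]
    exact ih g hgs i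

lemma ps_descent {ι κ : Type*} [Fintype κ] (J : Matrix ι κ ℝ⟦X⟧)
    (h0 : ∀ v, J *ᵥ v = 0 → ∀ e, coeff 0 (v e) = 0) (n : ℕ) :
    ∀ v, J *ᵥ v = 0 → ∀ e, coeff n (v e) = 0 := by
  induction n with
  | zero => exact h0
  | succ n ih =>
    intro v hv e
    have hd : ∀ i, ∃ g, v i = X * g := by
      intro i
      have : (X : ℝ⟦X⟧) ∣ v i := by
        rw [X_dvd_iff, ← coeff_zero_eq_constantCoeff_apply]; exact h0 v hv i
      exact this
    choose g hg using hd
    have hvg : v = (X : ℝ⟦X⟧) • g := by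
      funext i; simp [hg i]
    rw [hvg, Matrix.mulVec_smul] at hv
    have hgs : J *ᵥ g = 0 := by
      rcases smul_eq_zero.1 hv with h | h
      · exact absurd h X_ne_zero
      · exact h
    rw [hg e, coeff_succ_X_mul]
    exact ih g hgs e

lemma gram_ps_ne {p : ℕ} (E : Finset (Fin p × Fin p)) (A S : Fin p → Fin p → ℝ⟦X⟧)
    (T : Fin p → Fin p → Fin p → ℝ⟦X⟧)
    (h0 : ∀ v, genJac E A S T *ᵥ v = 0 → ∀ e, coeff 0 (v e) = 0) : gramDet E A S T ≠ 0 := by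
  intro hg
  unfold gramDet at hg
  rw [← Matrix.exists_mulVec_eq_zero_iff] at hg
  obtain ⟨v, hv, h⟩ := hg
  apply hv
  have hJ : genJac E A S T *ᵥ v = 0 := by
    have h1 : (genJac E A S T *ᵥ v) ⬝ᵥ (genJac E A S T *ᵥ v) = 0 := by
      have := congrArg (fun z => v ⬝ᵥ z) h
      simp only [dotProduct_zero] at this
      rw [← Matrix.mulVec_mulVec, Matrix.dotProduct_mulVec, Matrix.vecMul_transpose] at this
      exact this
    funext r
    ext n
    simpa using ps_sq_zero n (genJac E A S T *ᵥ v) h1 r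
  funext e
  ext n
  simpa using ps_descent (genJac E A S T) h0 n v hJ e

end PS2

lemma orient_aux {p : ℕ} (E : Finset (Fin p × Fin p)) (c : Fin p) :
    ∃ B : Fin p → Fin p → ℝ, (∀ i, B i i = 0) ∧ (∀ i j, (j, i) ∉ E → B i j = 0) ∧
      (∀ i j, i ≠ j → (i, j) ∈ E → (B i j = 1 ∧ B j i = 0) ∨ (B j i = 1 ∧ B i j = 0)) ∧
      (∀ i, i ≠ c → (c, i) ∈ E → B i c = 1) ∧
      (∀ i j, i ≠ j → (j, i) ∈ E → (i, j) ∉ E → B i j = 1) := by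
  classical
  refine ⟨fun a b => if (b, a) ∈ E ∧ a ≠ b ∧ ((a, b) ∉ E ∨ (a ≠ c ∧ (b = c ∨ b < a))) then 1 else 0,
    ?_, ?_, ?_, ?_, ?_⟩
  · intro i; simp
  · intro i j h; simp [h]
  · intro i j hij h
    by_cases h' : (j, i) ∈ E
    · rcases lt_trichotomy i j with hl | hl | hl
      · have := hl.not_gt
        by_cases h1 : i = c <;> by_cases h2 : j = c <;> simp_all [hij.symm]
      · exact absurd hl hij
      · have := hl.not_gt
        by_cases h1 : i = c <;> by_cases h2 : j = c <;> simp_all [hij.symm]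
    · right; simp [h, h', hij, hij.symm]
  · intro i h1 h2; simp [h1, h2]
  · intro i j h1 h2 h3; simp [h1, h2, h3]

lemma orient {p : ℕ} (hp : 3 ≤ p) (E : Finset (Fin p × Fin p))
    (hconn : (SimpleGraph.fromRel (fun i j : Fin p => (i, j) ∈ E)).Connected) :
    ∃ B : Fin p → Fin p → ℝ, (∀ i, B i i = 0) ∧ (∀ i j, (j, i) ∉ E → B i j = 0) ∧
      (∀ i j, i ≠ j → (i, j) ∈ E → (B i j = 1 ∧ B j i = 0) ∨ (B j i = 1 ∧ B i j = 0)) ∧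
      ∃ i₀ k₀ j₀ : Fin p, i₀ ≠ j₀ ∧ k₀ ≠ j₀ ∧ B i₀ j₀ = 1 ∧ B k₀ j₀ = 1 ∧ B j₀ i₀ = 0 ∧ B j₀ k₀ = 0 ∧
        (i₀ = k₀ → (i₀, j₀) ∉ E) := by
  have opp : ∀ (B : Fin p → Fin p → ℝ), (∀ i j, i ≠ j → (i, j) ∈ E →
      (B i j = 1 ∧ B j i = 0) ∨ (B j i = 1 ∧ B i j = 0)) → ∀ i j, i ≠ j → (i, j) ∈ E →
      B j i = 1 → B i j = 0 := by
    intro B hB i j h1 h2 h3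
    rcases hB i j h1 h2 with h | h
    · rw [h3] at h; exact absurd h.2 one_ne_zero
    · exact h.2
  by_cases hA : ∃ i j, i ≠ j ∧ (j, i) ∈ E ∧ (i, j) ∉ E
  · obtain ⟨i, j, h1, h2, h3⟩ := hA
    obtain ⟨B, b1, b2, b3, b4, b5⟩ := orient_aux E i
    have hb := b5 i j h1 h2 h3
    have hb' := opp B b3 j i h1.symm h2 hb
    exact ⟨B, b1, b2, b3, i, i, j, h1, h1, hb, hb, hb', hb', fun _ => h3⟩
  · push Not at hA
    have key : ∃ j i k, j ≠ i ∧ j ≠ k ∧ i ≠ k ∧ (j, i) ∈ E ∧ (j, k) ∈ E := by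
      set G := SimpleGraph.fromRel (fun i j : Fin p => (i, j) ∈ E) with hG
      have hadj : ∀ i j, G.Adj i j → i ≠ j ∧ (i, j) ∈ E ∧ (j, i) ∈ E := by
        intro i j h
        rw [hG, SimpleGraph.fromRel_adj] at h
        rcases h with ⟨h1, h2 | h2⟩
        · exact ⟨h1, h2, hA j i h1.symm h2⟩
        · exact ⟨h1, hA i j h1 h2, h2⟩
      let z : Fin p := ⟨0, by omega⟩
      let o : Fin p := ⟨1, by omega⟩
      have cross : ∀ (U : Set (Fin p)) t, z ∈ U → t ∉ U → ∃ x y, x ∈ U ∧ y ∉ U ∧ G.Adj x y := by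
        intro U t hz ht
        obtain ⟨w⟩ := hconn.preconnected z t
        obtain ⟨d, _, h1, h2⟩ := w.exists_boundary_dart U hz ht
        exact ⟨d.fst, d.snd, h1, h2, d.adj⟩
      obtain ⟨x, u, hx, hu, hxu⟩ := cross {z} o rfl (by simp [z, o])
      have hx' : x = z := hx
      rw [hx'] at hxu
      have : ∃ t : Fin p, t ∉ ({z, u} : Finset (Fin p)) := by
        by_contra hcon
        push Not at hcon
        have h1 : (Finset.univ : Finset (Fin p)) ⊆ {z, u} := fun t _ => hcon t
        have h2 := Finset.card_le_card h1
        have h3 := Finset.card_le_two (a := z) (b := u)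
        simp at h2
        omega
      obtain ⟨t, ht⟩ := this
      obtain ⟨x, y, hx, hy, hxy⟩ := cross (({z, u} : Finset (Fin p)) : Set (Fin p)) t (by simp)
        (by simpa using ht)
      have h1 := hadj _ _ hxu
      have h2 := hadj _ _ hxy
      simp at hx hy
      rcases hx with hx | hx
      · rw [hx] at h2
        exact ⟨z, u, y, h1.1, h2.1, fun h => hy.2 h.symm, h1.2.1, h2.2.1⟩
      · rw [hx] at h2
        exact ⟨u, z, y, h1.1.symm, h2.1, fun h => hy.1 h.symm, h1.2.2, h2.2.1⟩
    obtain ⟨j, i, k, h1, h2, h3, h4, h5⟩ := key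
    obtain ⟨B, b1, b2, b3, b4, b5⟩ := orient_aux E j
    have hi := b4 i h1.symm h4
    have hk := b4 k h2.symm h5
    exact ⟨B, b1, b2, b3, i, k, j, h1.symm, h2.symm, hi, hk, opp B b3 j i h1 h4 hi,
      opp B b3 j k h2 h5 hk, fun h => absurd h h3⟩
section FieldTheory

open scoped IntermediateField.algebraAdjoinAdjoin

lemma algebraic_of_der {F L : Type} [Field F] [Field L] [Algebra F L] [Algebra.EssFiniteType F L]
    (h : ∀ D : Derivation F L L, D = 0) (x : L) : IsAlgebraic F x := by
  have hsub : Subsingleton Ω[L⁄F] := by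
    refine ⟨fun a b => ?_⟩
    rw [← sub_eq_zero]
    rw [← Module.forall_dual_apply_eq_zero_iff L]
    intro f
    have h0 : f = 0 := by
      apply (KaehlerDifferential.linearMapEquivDerivation F L (M := L)).injective
      rw [h (KaehlerDifferential.linearMapEquivDerivation F L f), map_zero]
    rw [h0]; rfl
  have hu : Algebra.FormallyUnramified F L := ⟨hsub⟩
  have hs := (Algebra.FormallyUnramified.iff_isSeparable (K := F) L).1 hu
  exact (hs.isAlgebraic).isAlgebraic x

lemma der_zero_of_gen {L : Type} [Field L] [Algebra ℝ L] (s : Set L)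
    (hs : IntermediateField.adjoin ℝ s = ⊤) (F : IntermediateField ℝ L) (D : Derivation F L L)
    (hD : ∀ x ∈ s, D x = 0) : D = 0 := by
  ext x
  have hx : x ∈ IntermediateField.adjoin ℝ s := by rw [hs]; trivial
  induction hx using IntermediateField.adjoin_induction with
  | mem x hx => exact hD x hx
  | algebraMap x => exact D.map_algebraMap (algebraMap ℝ F x)
  | add x y _ _ h1 h2 => rw [D.map_add, h1, h2]; simp
  | inv x _ h => rw [D.leibniz_inv, h]; simp
  | mul x y _ _ h1 h2 => rw [D.leibniz, h1, h2]; simp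

lemma alg_poly {L : Type} [Field L] [Algebra ℝ L] {τ : Type} (s : τ → L) (x : L)
    (h : IsAlgebraic (IntermediateField.adjoin ℝ (Set.range s)) x) :
    ∃ P : Polynomial (MvPolynomial τ ℝ),
      P.map (MvPolynomial.aeval s : MvPolynomial τ ℝ →ₐ[ℝ] L).toRingHom ≠ 0 ∧
      (P.map (MvPolynomial.aeval s : MvPolynomial τ ℝ →ₐ[ℝ] L).toRingHom).eval x = 0 := by
  have h1 : IsAlgebraic (Algebra.adjoin ℝ (Set.range s)) x :=
    (IsFractionRing.isAlgebraic_iff (Algebra.adjoin ℝ (Set.range s))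
      (IntermediateField.adjoin ℝ (Set.range s)) L).2 h
  obtain ⟨Q, hQ, hx⟩ := h1
  let f : MvPolynomial τ ℝ →+* Algebra.adjoin ℝ (Set.range s) :=
    ((MvPolynomial.aeval s : MvPolynomial τ ℝ →ₐ[ℝ] L).codRestrict _ (by
      intro r
      rw [Algebra.adjoin_range_eq_range_aeval]
      exact ⟨r, rfl⟩)).toRingHom
  have hf : Function.Surjective f := by
    rintro ⟨y, hy⟩
    have hy' := hy
    rw [Algebra.adjoin_range_eq_range_aeval] at hy'
    obtain ⟨r, hr⟩ := hy'
    exact ⟨r, Subtype.ext hr⟩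
  obtain ⟨P, hP⟩ := Polynomial.map_surjective f hf Q
  have hcomp : (MvPolynomial.aeval s : MvPolynomial τ ℝ →ₐ[ℝ] L).toRingHom
      = (algebraMap (Algebra.adjoin ℝ (Set.range s)) L).comp f := rfl
  refine ⟨P, ?_, ?_⟩
  · rw [hcomp, ← Polynomial.map_map, hP]
    intro h0
    apply hQ
    exact Polynomial.map_injective _ (Subtype.val_injective) (by rw [h0]; simp)
  · rw [hcomp, ← Polynomial.map_map, hP, Polynomial.eval_map]
    exact hx

lemma generic_algebraic {p : ℕ} {L : Type} [Field L] [Algebra ℝ L] (E : Finset (Fin p × Fin p))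
    (A : Fin p → Fin p → L) (w₂ w₃ : Fin p → L) (S : Fin p → Fin p → L)
    (T : Fin p → Fin p → Fin p → L) (hA : ∀ i j, (i, j) ∉ E → A j i = 0)
    (hS : IsSol2 A w₂ S) (hT : IsSol3 A w₃ T) (hsymm : ∀ i j, S i j = S j i)
    (hg : gramDet E A S T ≠ 0) (s : Set L) (hsf : s.Finite)
    (hs : IntermediateField.adjoin ℝ s = ⊤)
    (hmem : ∀ x ∈ s, (∃ i j, x = A i j) ∨ (∃ i, x = w₂ i) ∨ (∃ i, x = w₃ i))
    (F : IntermediateField ℝ L) (hFS : ∀ i j, S i j ∈ F) (hFT : ∀ i j k, T i j k ∈ F) (x : L) :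
    IsAlgebraic F x := by
  have hess : Algebra.EssFiniteType ℝ L := by
    have h1 : (⊤ : IntermediateField ℝ L).FG := by
      rw [← hs]; exact IntermediateField.fg_adjoin_of_finite hsf
    exact IntermediateField.fg_top_iff.1 h1
  have hess' : Algebra.EssFiniteType F L := Algebra.EssFiniteType.of_comp ℝ F L
  apply algebraic_of_der
  intro D
  have dS : ∀ i j, D (S i j) = 0 := fun i j => D.map_algebraMap (⟨S i j, hFS i j⟩ : F)
  have dT : ∀ i j k, D (T i j k) = 0 := fun i j k => D.map_algebraMap (⟨T i j k, hFT i j k⟩ : F)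
  -- differentiate the equations
  have e2 : ∀ i j, (∑ a, D (A j a) * ∑ l, A i l * S l a) + (∑ a, D (A i a) * ∑ k, A j k * S k a)
      + (if i = j then D (w₂ i) else 0) = 0 := by
    intro i j
    have h := congrArg D (hS i j)
    rw [dS, map_add, map_sum] at h
    refine Eq.trans ?_ h.symm
    congr 1
    · simp only [map_sum, Derivation.leibniz, dS, smul_eq_mul, mul_zero, zero_add, mul_add,
        Finset.sum_add_distrib, Finset.mul_sum]
      rw [Finset.sum_comm]
      congr 1
      · exact Finset.sum_congr rfl fun _ _ => Finset.sum_congr rfl fun _ _ => by ring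
      · exact Finset.sum_congr rfl fun _ _ => Finset.sum_congr rfl fun _ _ => by
          rw [hsymm]; ring
    · split_ifs <;> simp
  have e3 : ∀ i j k, (∑ a, D (A i a) * ∑ m, ∑ n, A j m * A k n * T a m n)
      + (∑ a, D (A j a) * ∑ l, ∑ n, A i l * A k n * T l a n)
      + (∑ a, D (A k a) * ∑ l, ∑ m, A i l * A j m * T l m a)
      + (if i = j ∧ j = k then D (w₃ i) else 0) = 0 := by
    intro i j k
    have h := congrArg D (hT i j k)
    rw [dT, map_add] at h
    refine Eq.trans ?_ h.symm
    congr 1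
    · have hl : ∀ l m n, D (A i l * A j m * A k n * T l m n)
          = D (A i l) * (A j m * A k n * T l m n) + D (A j m) * (A i l * A k n * T l m n)
            + D (A k n) * (A i l * A j m * T l m n) := by
        intro l m n
        simp only [Derivation.leibniz, dT, smul_eq_mul]
        ring
      simp only [map_sum, hl, Finset.sum_add_distrib, Finset.mul_sum]
      congr 1
      · congr 1
        rw [Finset.sum_comm]
      · rw [Finset.sum_comm]
        exact Finset.sum_congr rfl fun _ _ => Finset.sum_comm
    · split_ifs <;> simp
  have hext : ext0 E (fun e => D (A e.1.2 e.1.1)) = fun i j => D (A i j) := by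
    funext b a
    unfold ext0
    split_ifs with h
    · rfl
    · rw [hA a b h, map_zero]
  have hker := ker_of_gramDet E A S T hg (fun e => D (A e.1.2 e.1.1)) (by
    funext r
    rcases r with ⟨⟨i, j⟩, h⟩ | ⟨⟨i, j, k⟩, h⟩
    · rw [genJac_mulVec_inl, hext]
      have := e2 i j
      rw [if_neg h, add_zero] at this
      exact this
    · rw [genJac_mulVec_inr, hext]
      have := e3 i j k
      rw [if_neg h, add_zero] at this
      exact this)
  have dA : ∀ i j, D (A i j) = 0 := by
    intro i j
    have h1 : ext0 E (fun e => D (A e.1.2 e.1.1)) i j = 0 := by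
      rw [hker]; simp [ext0]
    rw [hext] at h1
    exact h1
  have dw2 : ∀ i, D (w₂ i) = 0 := by
    intro i
    have := e2 i i
    simpa [dA] using this
  have dw3 : ∀ i, D (w₃ i) = 0 := by
    intro i
    have := e3 i i i
    simpa [dA] using this
  apply der_zero_of_gen s hs
  intro x hx
  rcases hmem x hx with ⟨i, j, rfl⟩ | ⟨i, rfl⟩ | ⟨i, rfl⟩
  · exact dA i j
  · exact dw2 i
  · exact dw3 i

end FieldTheory
section Assemble

variable {p : ℕ}

/-- the type of parameter coordinates -/
abbrev Par (E : Finset (Fin p × Fin p)) : Type := {e : Fin p × Fin p // e ∈ E} ⊕ (Fin 2 × Fin p)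

/-- the matrix of a parameter point -/
def parA {K : Type*} [CommRing K] (E : Finset (Fin p × Fin p)) (θ : Par E → K) :
    Fin p → Fin p → K := ext0 E fun e => θ (Sum.inl e)

lemma parA_map {K K' : Type*} [CommRing K] [CommRing K'] (f : K →+* K')
    (E : Finset (Fin p × Fin p)) (θ : Par E → K) :
    (fun i j => f (parA E θ i j)) = parA E (fun x => f (θ x)) := by
  funext i j
  simp only [parA, ext0]
  split_ifs <;> simp

/-- the universal denominator -/
noncomputable def dpoly (E : Finset (Fin p × Fin p)) : MvPolynomial (Par E) ℝ :=
  (M2 (parA E MvPolynomial.X)).det * (M3 (parA E MvPolynomial.X)).det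

lemma aeval_dpoly {K : Type*} [CommRing K] [Algebra ℝ K] (E : Finset (Fin p × Fin p))
    (θ : Par E → K) :
    MvPolynomial.aeval θ (dpoly E) = (M2 (parA E θ)).det * (M3 (parA E θ)).det := by
  have h := parA_map (MvPolynomial.aeval θ : MvPolynomial (Par E) ℝ →ₐ[ℝ] K).toRingHom E
    MvPolynomial.X
  have h2 := map_det_M2 (MvPolynomial.aeval θ : MvPolynomial (Par E) ℝ →ₐ[ℝ] K).toRingHom
    (parA E MvPolynomial.X)
  have h3 := map_det_M3 (MvPolynomial.aeval θ : MvPolynomial (Par E) ℝ →ₐ[ℝ] K).toRingHom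
    (parA E MvPolynomial.X)
  rw [h] at h2 h3
  simp only [AlgHom.toRingHom_eq_coe, RingHom.coe_coe, MvPolynomial.aeval_X] at h2 h3
  rw [dpoly, map_mul, h2, h3]

/-- the ring of rational functions in which the cumulants live -/
abbrev Rd (E : Finset (Fin p × Fin p)) : Type := Localization.Away (dpoly E)

lemma exists_lift {K : Type*} [CommRing K] [Algebra ℝ K] (E : Finset (Fin p × Fin p))
    (θ : Par E → K) (h : IsUnit (MvPolynomial.aeval θ (dpoly E))) :
    ∃ ψ : Rd E →+* K, ∀ r : MvPolynomial (Par E) ℝ,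
      ψ (algebraMap _ (Rd E) r) = MvPolynomial.aeval θ r :=
  ⟨IsLocalization.Away.lift (dpoly E)
    (g := (MvPolynomial.aeval θ : MvPolynomial (Par E) ℝ →ₐ[ℝ] K).toRingHom) h,
    fun r => IsLocalization.Away.lift_eq (dpoly E) _ r⟩

/-- the generic point -/
noncomputable def gpt (E : Finset (Fin p × Fin p)) (x : Par E) : Rd E :=
  algebraMap (MvPolynomial (Par E) ℝ) (Rd E) (MvPolynomial.X x)

lemma isUnit_gen (E : Finset (Fin p × Fin p)) :
    IsUnit (M2 (parA E (gpt E))).det ∧ IsUnit (M3 (parA E (gpt E))).det := by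
  have h : IsUnit (algebraMap _ (Rd E) (dpoly E)) :=
    IsLocalization.Away.algebraMap_isUnit (dpoly E)
  have h1 := aeval_dpoly E (gpt E)
  have h2 : MvPolynomial.aeval (gpt E) (dpoly E) = algebraMap _ (Rd E) (dpoly E) := by
    have : (MvPolynomial.aeval (gpt E) : MvPolynomial (Par E) ℝ →ₐ[ℝ] Rd E)
        = IsScalarTower.toAlgHom ℝ (MvPolynomial (Par E) ℝ) (Rd E) := by
      apply MvPolynomial.algHom_ext
      intro x
      simp [gpt]
    rw [this]; rfl
  rw [← h2, h1] at h
  exact IsUnit.mul_iff.1 h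

open PowerSeries in
lemma ps_point (hp : 3 ≤ p) (E : Finset (Fin p × Fin p)) (hself : ∀ i : Fin p, (i, i) ∈ E)
    (hconn : (SimpleGraph.fromRel (fun i j : Fin p => (i, j) ∈ E)).Connected) :
    ∃ θ : Par E → ℝ⟦X⟧, IsUnit (MvPolynomial.aeval θ (dpoly E)) ∧
      ∀ S T, IsSol2 (parA E θ) (fun i => θ (Sum.inr (0, i))) S →
        IsSol3 (parA E θ) (fun i => θ (Sum.inr (1, i))) T → gramDet E (parA E θ) S T ≠ 0 := by
  obtain ⟨B, b0, bs, bo, i₀, k₀, j₀, h1, h2, h3, h4, h5, h6, h7⟩ := orient hp E hconn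
  let θ : Par E → ℝ⟦X⟧ := Sum.elim (fun e => Aps B e.1.2 e.1.1)
    (fun ki => if ki.1 = 0 then C (3/4) else C (9/8))
  have hA : parA E θ = Aps B := by
    funext i j
    simp only [parA, ext0]
    split_ifs with h
    · rfl
    · have hij : i ≠ j := by rintro rfl; exact h (hself i)
      simp [Aps, hij, bs i j h]
  refine ⟨θ, ?_, ?_⟩
  · rw [aeval_dpoly, hA, IsUnit.mul_iff]
    have hc : (fun i j => constantCoeff (Aps B i j)) = fun i j => if i = j then (-1/2 : ℝ) else 0 := by
      funext i j
      rw [← coeff_zero_eq_constantCoeff_apply, Aps_c0]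
    rw [PowerSeries.isUnit_iff_constantCoeff, PowerSeries.isUnit_iff_constantCoeff,
      map_det_M2, map_det_M3, hc]
    constructor
    · have : M2 (fun i j : Fin p => if i = j then (-1/2 : ℝ) else 0) = (3/4 : ℝ) • 1 := by
        ext ⟨a, b⟩ ⟨c, d⟩
        simp only [M2, Matrix.sub_apply, Matrix.one_apply, Matrix.of_apply, Matrix.smul_apply,
          Prod.mk.injEq]
        by_cases h : a = c <;> by_cases h' : b = d <;> simp [h, h'] <;> norm_num
      rw [this, Matrix.det_smul, Matrix.det_one, isUnit_iff_ne_zero]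
      positivity
    · have : M3 (fun i j : Fin p => if i = j then (-1/2 : ℝ) else 0) = (9/8 : ℝ) • 1 := by
        ext ⟨a, b, c⟩ ⟨a', b', c'⟩
        simp only [M3, Matrix.sub_apply, Matrix.one_apply, Matrix.of_apply, Matrix.smul_apply,
          Prod.mk.injEq]
        by_cases h : a = a' <;> by_cases h' : b = b' <;> by_cases h'' : c = c' <;>
          simp [h, h', h''] <;> norm_num
      rw [this, Matrix.det_smul, Matrix.det_one, isUnit_iff_ne_zero]
      positivity
  · intro S T hS hT
    rw [hA] at hS hT ⊢
    have hS' : IsSol2 (Aps B) (fun _ => C (3/4)) S := by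
      simpa [θ] using hS
    have hT' : IsSol3 (Aps B) (fun _ => C (9/8)) T := by
      simpa [θ] using hT
    exact gram_ps_ne E _ S T fun v hv =>
      ps_kernel E B S T hS' hT' hconn b0 bo i₀ k₀ j₀ h1 h2 h3 h4 h5 h6 h7 v hv

lemma gpt_map {K : Type*} [CommRing K] [Algebra ℝ K] (E : Finset (Fin p × Fin p))
    (θ : Par E → K) (ψ : Rd E →+* K) (hψ : ∀ r : MvPolynomial (Par E) ℝ,
      ψ (algebraMap _ (Rd E) r) = MvPolynomial.aeval θ r) (x : Par E) : ψ (gpt E x) = θ x := by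
  rw [gpt, hψ, MvPolynomial.aeval_X]

lemma sol2_push {K : Type*} [CommRing K] [Algebra ℝ K] (E : Finset (Fin p × Fin p))
    (θ : Par E → K) (ψ : Rd E →+* K) (hψ : ∀ x, ψ (gpt E x) = θ x) (S : Fin p → Fin p → Rd E)
    (hS : IsSol2 (parA E (gpt E)) (fun i => gpt E (Sum.inr (0, i))) S) :
    IsSol2 (parA E θ) (fun i => θ (Sum.inr (0, i))) (fun i j => ψ (S i j)) := by
  have := hS.map ψ
  rw [parA_map] at this
  simpa only [hψ] using this

lemma sol3_push {K : Type*} [CommRing K] [Algebra ℝ K] (E : Finset (Fin p × Fin p))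
    (θ : Par E → K) (ψ : Rd E →+* K) (hψ : ∀ x, ψ (gpt E x) = θ x)
    (T : Fin p → Fin p → Fin p → Rd E)
    (hT : IsSol3 (parA E (gpt E)) (fun i => gpt E (Sum.inr (1, i))) T) :
    IsSol3 (parA E θ) (fun i => θ (Sum.inr (1, i))) (fun i j k => ψ (T i j k)) := by
  have := hT.map ψ
  rw [parA_map] at this
  simpa only [hψ] using this

lemma gram_push {K : Type*} [CommRing K] (E : Finset (Fin p × Fin p))
    (θ : Par E → K) (ψ : Rd E →+* K) (hψ : ∀ x, ψ (gpt E x) = θ x) (S : Fin p → Fin p → Rd E)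
    (T : Fin p → Fin p → Fin p → Rd E) :
    ψ (gramDet E (parA E (gpt E)) S T)
      = gramDet E (parA E θ) (fun i j => ψ (S i j)) (fun i j k => ψ (T i j k)) := by
  rw [gramDet_map, parA_map]
  simp only [hψ]

/-- a nonzero rational function is nonvanishing off a hypersurface -/
lemma exists_num (E : Finset (Fin p × Fin p)) (h : Rd E) (hh : h ≠ 0) :
    ∃ q : MvPolynomial (Par E) ℝ, q ≠ 0 ∧ ∀ (θ : Par E → ℝ) (ψ : Rd E →+* ℝ),
      (∀ r : MvPolynomial (Par E) ℝ, ψ (algebraMap _ (Rd E) r) = MvPolynomial.aeval θ r) →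
      MvPolynomial.aeval θ q ≠ 0 → ψ h ≠ 0 := by
  obtain ⟨n, a, ha⟩ := IsLocalization.Away.surj (dpoly E) h
  have hu : IsUnit (algebraMap _ (Rd E) (dpoly E)) :=
    IsLocalization.Away.algebraMap_isUnit (dpoly E)
  refine ⟨a, ?_, ?_⟩
  · rintro rfl
    rw [map_zero] at ha
    exact hh ((hu.pow n).mul_left_eq_zero.1 ha)
  · intro θ ψ hψ hne h0
    apply hne
    rw [← hψ, ← ha, map_mul, h0, zero_mul]

/-- the parameter point of a triple -/
def rpt (E : Finset (Fin p × Fin p)) (A : Matrix (Fin p) (Fin p) ℝ) (w₂ w₃ : Fin p → ℝ) :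
    Par E → ℝ :=
  Sum.elim (fun e : {e : Fin p × Fin p // e ∈ E} => A e.1.2 e.1.1)
    (fun ki : Fin 2 × Fin p => ![w₂, w₃] ki.1 ki.2)

lemma real_point (E : Finset (Fin p × Fin p)) (S : Fin p → Fin p → Rd E)
    (T : Fin p → Fin p → Fin p → Rd E)
    (hS : IsSol2 (parA E (gpt E)) (fun i => gpt E (Sum.inr (0, i))) S)
    (hT : IsSol3 (parA E (gpt E)) (fun i => gpt E (Sum.inr (1, i))) T)
    (A : Matrix (Fin p) (Fin p) ℝ) (w₂ w₃ : Fin p → ℝ)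
    (hsupp : ∀ i j : Fin p, (i, j) ∉ E → A j i = 0)
    (hA : ∀ μ ∈ spectrum ℂ (A.map (algebraMap ℝ ℂ)), ‖μ‖ < 1) :
    parA E (rpt E A w₂ w₃) = (fun i j => A i j) ∧
    ∃ ψ : Rd E →+* ℝ, (∀ r : MvPolynomial (Par E) ℝ,
        ψ (algebraMap _ (Rd E) r) = MvPolynomial.aeval (rpt E A w₂ w₃) r) ∧
      (∀ x, ψ (gpt E x) = rpt E A w₂ w₃ x) ∧
      (fun i j => ψ (S i j)) = (fun i j => steadyCumulant p 2 A w₂ ![i, j]) ∧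
      (fun i j k => ψ (T i j k)) = (fun i j k => steadyCumulant p 3 A w₃ ![i, j, k]) := by
  have hpar : parA E (rpt E A w₂ w₃) = (fun i j => A i j) := by
    funext i j
    simp only [parA, ext0]
    split_ifs with h
    · rfl
    · exact (hsupp j i h).symm
  have h2 := isUnit_iff_ne_zero.2 (det_M2_ne A hA)
  have h3 := isUnit_iff_ne_zero.2 (det_M3_ne A hA)
  obtain ⟨ψ, hψ⟩ := exists_lift E (rpt E A w₂ w₃) (by
    rw [aeval_dpoly, hpar]; exact h2.mul h3)
  have hg := gpt_map E _ ψ hψ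
  refine ⟨hpar, ψ, hψ, hg, ?_, ?_⟩
  · have := sol2_push E _ ψ hg S hS
    rw [hpar] at this
    exact IsSol2.unique h2 this (steady2 A hA w₂)
  · have := sol3_push E _ ψ hg T hT
    rw [hpar] at this
    exact IsSol3.unique h3 this (steady3 A hA w₃)

lemma gen_adjoin (E : Finset (Fin p × Fin p)) [IsDomain (Rd E)] :
    IntermediateField.adjoin ℝ
      (Set.range fun x : Par E => algebraMap (Rd E) (FractionRing (Rd E)) (gpt E x)) = ⊤ := by
  rw [eq_top_iff]
  intro z _
  set F := IntermediateField.adjoin ℝ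
      (Set.range fun x : Par E => algebraMap (Rd E) (FractionRing (Rd E)) (gpt E x)) with hF
  have hR : ∀ r : MvPolynomial (Par E) ℝ,
      algebraMap (Rd E) (FractionRing (Rd E)) (algebraMap _ (Rd E) r) ∈ F := by
    intro r
    induction r using MvPolynomial.induction_on with
    | C a =>
      have : algebraMap (Rd E) (FractionRing (Rd E)) (algebraMap (MvPolynomial (Par E) ℝ) (Rd E) (MvPolynomial.C a))
          = algebraMap ℝ (FractionRing (Rd E)) a := by
        rw [← MvPolynomial.algebraMap_eq, ← IsScalarTower.algebraMap_apply,
          ← IsScalarTower.algebraMap_apply]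
      rw [this]
      exact F.algebraMap_mem a
    | add f g hf hg => rw [map_add, map_add]; exact add_mem hf hg
    | mul_X f x hf =>
      rw [map_mul, map_mul]
      exact mul_mem hf (IntermediateField.subset_adjoin _ _ ⟨x, rfl⟩)
  have hRd : ∀ r : Rd E, algebraMap (Rd E) (FractionRing (Rd E)) r ∈ F := by
    intro r
    obtain ⟨n, a, ha⟩ := IsLocalization.Away.surj (dpoly E) r
    have hu : IsUnit (algebraMap _ (Rd E) (dpoly E)) :=
      IsLocalization.Away.algebraMap_isUnit (dpoly E)
    have h1 := congrArg (algebraMap (Rd E) (FractionRing (Rd E))) ha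
    have hu2 := (hu.pow n).map (algebraMap (Rd E) (FractionRing (Rd E)))
    rw [map_mul] at h1
    rw [(eq_div_iff hu2.ne_zero).2 h1, map_pow]
    exact div_mem (hR a) (pow_mem (hR _) n)
  obtain ⟨x, y, _, rfl⟩ := IsFractionRing.div_surjective (A := Rd E) z
  exact div_mem (hRd x) (hRd y)

/-- the index set of the cumulants -/
abbrev Cum (p : ℕ) : Type := (Fin p × Fin p) ⊕ (Fin p × Fin p × Fin p)

/-- the cumulants as a family -/
def cumFam {K : Type*} (S : Fin p → Fin p → K) (T : Fin p → Fin p → Fin p → K) : Cum p → K :=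
  Sum.elim (fun x => S x.1 x.2) (fun x => T x.1 x.2.1 x.2.2)

/-- every coordinate satisfies a polynomial relation over the cumulants -/
lemma exists_rel (E : Finset (Fin p × Fin p)) [IsDomain (Rd E)] (S : Fin p → Fin p → Rd E)
    (T : Fin p → Fin p → Fin p → Rd E)
    (hS : IsSol2 (parA E (gpt E)) (fun i => gpt E (Sum.inr (0, i))) S)
    (hT : IsSol3 (parA E (gpt E)) (fun i => gpt E (Sum.inr (1, i))) T)
    (hg : gramDet E (parA E (gpt E)) S T ≠ 0) (x : Par E) :
    ∃ P : Polynomial (MvPolynomial (Cum p) ℝ),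
      P.map (MvPolynomial.aeval (cumFam S T) : MvPolynomial (Cum p) ℝ →ₐ[ℝ] Rd E).toRingHom ≠ 0 ∧
      (P.map (MvPolynomial.aeval (cumFam S T) :
        MvPolynomial (Cum p) ℝ →ₐ[ℝ] Rd E).toRingHom).eval (gpt E x) = 0 := by
  let L := FractionRing (Rd E)
  let ι : Rd E →+* L := algebraMap (Rd E) L
  have hι : Function.Injective ι := IsFractionRing.injective (Rd E) L
  let s : Cum p → L := fun c => ι (cumFam S T c)
  have halg : IsAlgebraic (IntermediateField.adjoin ℝ (Set.range s)) (ι (gpt E x)) := by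
    refine generic_algebraic E (parA E fun x => ι (gpt E x)) (fun i => ι (gpt E (Sum.inr (0, i))))
      (fun i => ι (gpt E (Sum.inr (1, i)))) (fun i j => ι (S i j)) (fun i j k => ι (T i j k))
      ?_ (sol2_push E _ ι (fun _ => rfl) S hS) (sol3_push E _ ι (fun _ => rfl) T hT) ?_ ?_
      (Set.range fun x : Par E => algebraMap (Rd E) (FractionRing (Rd E)) (gpt E x))
      (Set.finite_range _) (gen_adjoin E) ?_ _ ?_ ?_ _
    · intro i j h
      simp [parA, ext0, h]
    · intro i j
      exact congrArg ι (hS.symm (isUnit_gen E).1 i j)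
    · rw [← gram_push E _ ι (fun _ => rfl) S T]
      exact fun h => hg (hι (by rw [h, map_zero]))
    · rintro _ ⟨y, rfl⟩
      rcases y with ⟨⟨a, b⟩, he⟩ | ⟨k, i⟩
      · exact Or.inl ⟨b, a, by simp only [parA, ext0, he, dite_true]; rfl⟩
      · fin_cases k
        · exact Or.inr (Or.inl ⟨i, rfl⟩)
        · exact Or.inr (Or.inr ⟨i, rfl⟩)
    · intro i j
      exact IntermediateField.subset_adjoin _ _ ⟨Sum.inl (i, j), rfl⟩
    · intro i j k
      exact IntermediateField.subset_adjoin _ _ ⟨Sum.inr (i, j, k), rfl⟩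
  obtain ⟨P, hP, hx⟩ := alg_poly s _ halg
  have hcomp : (MvPolynomial.aeval s : MvPolynomial (Cum p) ℝ →ₐ[ℝ] L).toRingHom
      = ι.comp (MvPolynomial.aeval (cumFam S T) :
        MvPolynomial (Cum p) ℝ →ₐ[ℝ] Rd E).toRingHom := by
    have : (MvPolynomial.aeval s : MvPolynomial (Cum p) ℝ →ₐ[ℝ] L)
        = (IsScalarTower.toAlgHom ℝ (Rd E) L).comp (MvPolynomial.aeval (cumFam S T) :
        MvPolynomial (Cum p) ℝ →ₐ[ℝ] Rd E) := by
      apply MvPolynomial.algHom_ext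
      intro c
      simp [s, ι]
    rw [this]; rfl
  rw [hcomp, ← Polynomial.map_map] at hP hx
  refine ⟨P, ?_, ?_⟩
  · intro h; rw [h] at hP; simp at hP
  · rw [Polynomial.eval_map, Polynomial.eval₂_hom] at hx
    exact hι (by rw [hx, map_zero])

end Assemble
/-- For a connected directed graph with all self-loops on `p ≥ 3`
nodes, generically the off-diagonal modified Jacobian has full rank `|E|` and the model
is locally identifiable from second- and third-order cumulants. -/
theorem stmt_10 (p : ℕ) (hp : 3 ≤ p) (E : Finset (Fin p × Fin p))
    (hself : ∀ i : Fin p, (i, i) ∈ E)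
    (hconn : (SimpleGraph.fromRel (fun i j : Fin p => (i, j) ∈ E)).Connected) :
    ∃ q : MvPolynomial ({e : Fin p × Fin p // e ∈ E} ⊕ (Fin 2 × Fin p)) ℝ,
      q ≠ 0 ∧
      ∀ (A : Matrix (Fin p) (Fin p) ℝ) (w₂ w₃ : Fin p → ℝ),
        (∀ i j : Fin p, (i, j) ∉ E → A j i = 0) →
        (∀ μ ∈ spectrum ℂ (A.map (algebraMap ℝ ℂ)), ‖μ‖ < 1) →
        (∀ i : Fin p, 0 < w₂ i) → (∀ i : Fin p, w₃ i ≠ 0) →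
        MvPolynomial.eval
          (Sum.elim (fun e : {e : Fin p × Fin p // e ∈ E} => A e.1.2 e.1.1)
            (fun ki : Fin 2 × Fin p => ![w₂, w₃] ki.1 ki.2)) q ≠ 0 →
        (offDiagModJac p E A
            (fun i j => steadyCumulant p 2 A w₂ ![i, j])
            (fun i j k => steadyCumulant p 3 A w₃ ![i, j, k])).rank = E.card ∧
        Set.Finite {θ' : Matrix (Fin p) (Fin p) ℝ × (Fin p → ℝ) × (Fin p → ℝ) |
          (∀ i j : Fin p, (i, j) ∉ E → θ'.1 j i = 0) ∧
          (∀ μ ∈ spectrum ℂ (θ'.1.map (algebraMap ℝ ℂ)), ‖μ‖ < 1) ∧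
          (∀ i : Fin p, 0 < θ'.2.1 i) ∧ (∀ i : Fin p, θ'.2.2 i ≠ 0) ∧
          steadyCumulant p 2 θ'.1 θ'.2.1 = steadyCumulant p 2 A w₂ ∧
          steadyCumulant p 3 θ'.1 θ'.2.2 = steadyCumulant p 3 A w₃} := by
  obtain ⟨θ₀, hu₀, hg₀⟩ := ps_point hp E hself hconn
  obtain ⟨ψ₀, hψ₀⟩ := exists_lift E θ₀ hu₀
  have hd0 : dpoly E ≠ 0 := by
    intro h
    rw [h, map_zero] at hu₀
    exact not_isUnit_zero hu₀
  have : IsDomain (Rd E) := IsLocalization.isDomain_localization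
    (powers_le_nonZeroDivisors_of_noZeroDivisors hd0)
  obtain ⟨S, hS⟩ := exists_sol2 (parA E (gpt E)) (fun i => gpt E (Sum.inr (0, i))) (isUnit_gen E).1
  obtain ⟨T, hT⟩ := exists_sol3 (parA E (gpt E)) (fun i => gpt E (Sum.inr (1, i))) (isUnit_gen E).2
  have hgp₀ := gpt_map E θ₀ ψ₀ hψ₀
  have hg : gramDet E (parA E (gpt E)) S T ≠ 0 := by
    intro h
    have h1 := gram_push E θ₀ ψ₀ hgp₀ S T
    rw [h, map_zero] at h1
    exact hg₀ _ _ (sol2_push E θ₀ ψ₀ hgp₀ S hS) (sol3_push E θ₀ ψ₀ hgp₀ T hT) h1.symm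
  choose P hP hPx using exists_rel E S T hS hT hg
  have hcoef : ∀ x, ∃ n, MvPolynomial.aeval (cumFam S T) ((P x).coeff n) ≠ 0 := by
    intro x
    by_contra hcon
    push Not at hcon
    apply hP x
    ext n
    rw [Polynomial.coeff_map, Polynomial.coeff_zero]
    exact hcon n
  choose n hn using hcoef
  obtain ⟨qg, hqg, hqg'⟩ := exists_num E _ hg
  have hq := fun x => exists_num E _ (hn x)
  choose qx hqx hqx' using hq
  refine ⟨qg * ∏ x, qx x, mul_ne_zero hqg (Finset.prod_ne_zero_iff.2 fun x _ => hqx x), ?_⟩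
  intro A w₂ w₃ hsupp hA _ _ hne
  change MvPolynomial.eval (rpt E A w₂ w₃) _ ≠ 0 at hne
  obtain ⟨hpar, ψ, hψ, hgp, hψS, hψT⟩ := real_point E S T hS hT A w₂ w₃ hsupp hA
  rw [map_mul, map_prod] at hne
  have hne1 := left_ne_zero_of_mul hne
  have hne2 : ∀ x, MvPolynomial.eval (rpt E A w₂ w₃) (qx x) ≠ 0 := fun x =>
    Finset.prod_ne_zero_iff.1 (right_ne_zero_of_mul hne) x (Finset.mem_univ x)
  constructor
  · rw [genJac_real]
    apply rank_of_gramDet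
    have h1 := hqg' (rpt E A w₂ w₃) ψ hψ (by rwa [MvPolynomial.aeval_eq_eval])
    rw [gram_push E _ ψ hgp S T, hpar, hψS, hψT] at h1
    exact h1
  · -- evaluation of the relations at a point with given cumulants
    have hev : ∀ (ψ' : Rd E →+* ℝ), ψ'.comp (MvPolynomial.aeval (cumFam S T) :
        MvPolynomial (Cum p) ℝ →ₐ[ℝ] Rd E).toRingHom
        = (MvPolynomial.aeval (cumFam (fun i j => ψ' (S i j)) (fun i j k => ψ' (T i j k))) :
          MvPolynomial (Cum p) ℝ →ₐ[ℝ] ℝ).toRingHom := by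
      intro ψ'
      apply MvPolynomial.ringHom_ext
      · intro r
        have : ψ'.comp (algebraMap ℝ (Rd E)) = RingHom.id ℝ := Subsingleton.elim _ _
        have h1 : ψ' (algebraMap ℝ (Rd E) r) = r := RingHom.congr_fun this r
        simpa using h1
      · intro c
        rcases c with c | c <;> simp [cumFam]
    set cm : Cum p → ℝ := cumFam (fun i j => steadyCumulant p 2 A w₂ ![i, j])
      (fun i j k => steadyCumulant p 3 A w₃ ![i, j, k]) with hcm
    let Q : Par E → Polynomial ℝ := fun x =>
      (P x).map (MvPolynomial.aeval cm : MvPolynomial (Cum p) ℝ →ₐ[ℝ] ℝ).toRingHom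
    have hQ : ∀ x, Q x ≠ 0 := by
      intro x h
      have h1 := hqx' x (rpt E A w₂ w₃) ψ hψ (by rw [MvPolynomial.aeval_eq_eval]; exact hne2 x)
      apply h1
      have h2 := congrArg (fun f => f ((P x).coeff (n x))) (hev ψ)
      rw [hψS, hψT, ← hcm] at h2
      refine h2.trans ?_
      have h3 := congrArg (fun f => Polynomial.coeff f (n x)) h
      simpa only [Q, Polynomial.coeff_map, Polynomial.coeff_zero] using h3
    have hfin : Set.Finite {θ : Par E → ℝ | ∀ x, θ x ∈ (Q x).rootSet ℝ} := by
      have := Set.Finite.pi' (fun x : Par E => (Polynomial.rootSet_finite (Q x) ℝ))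
      exact this
    refine Set.Finite.of_finite_image (f := fun θ' => rpt E θ'.1 θ'.2.1 θ'.2.2)
      (hfin.subset ?_) ?_
    · rintro _ ⟨⟨A', w₂', w₃'⟩, ⟨h1, h2, _, _, h5, h6⟩, rfl⟩ x
      obtain ⟨hpar', ψ', hψ', hgp', hψS', hψT'⟩ := real_point E S T hS hT A' w₂' w₃' h1 h2
      rw [Polynomial.mem_rootSet]
      refine ⟨hQ x, ?_⟩
      have h7 := congrArg ψ' (hPx x)
      rw [map_zero, ← Polynomial.eval₂_hom, ← Polynomial.eval_map, Polynomial.map_map, hev ψ', hψS',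
        hψT', hgp'] at h7
      simp only [] at h5 h6
      rw [h5, h6] at h7
      rw [Polynomial.coe_aeval_eq_eval]
      exact h7
    · rintro ⟨A', w₂', w₃'⟩ ⟨h1, _⟩ ⟨A'', w₂'', w₃''⟩ ⟨h1', _⟩ heq
      simp only [] at heq h1 h1'
      have hAA : A' = A'' := by
        ext i j
        by_cases h : (j, i) ∈ E
        · exact congrFun heq (Sum.inl ⟨(j, i), h⟩)
        · rw [h1 j i h, h1' j i h]
      have hw2 : w₂' = w₂'' := funext fun i => congrFun heq (Sum.inr (0, i))
      have hw3 : w₃' = w₃'' := funext fun i => congrFun heq (Sum.inr (1, i))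
      rw [hAA, hw2, hw3]
end
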